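/- Let P be a finite set of n points in the plane such that no line contains more than n - 3 points of P, and for each i ≥ 2 let t_i denote the number of lines containing exactly i points of P. Then t₂ + (3/4)·t₃ ≥ n + Σ_{i ≥ 5} (2i - 9)·t_i (Hirzebruch's inequality). -/

import Mathlib

open scoped Classical

noncomputable section

/-- A line in the plane: the affine span of two distinct points. -/
def IsLine (L : Set (ℝ × ℝ)) : Prop :=
  ∃ p q : ℝ × ℝ, p ≠ q ∧ L = (affineSpan ℝ ({p, q} : Set (ℝ × ℝ)) : Set (ℝ × ℝ))

/-- The points of the finite set `P` lying on `L`. -/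
def ptsOn (P : Finset (ℝ × ℝ)) (L : Set (ℝ × ℝ)) : Finset (ℝ × ℝ) :=
  P.filter (fun x => x ∈ L)

/-- A line determined by `P`: contains at least two points of `P`. -/
def DeterminedLine (P : Finset (ℝ × ℝ)) (L : Set (ℝ × ℝ)) : Prop :=
  IsLine L ∧ 2 ≤ (ptsOn P L).card

/-- A bichromatic line: determined by `R ∪ B`, with at least one red and one blue point. -/
def BichromaticLine (R B : Finset (ℝ × ℝ)) (L : Set (ℝ × ℝ)) : Prop :=
  DeterminedLine (R ∪ B) L ∧ (∃ p ∈ R, p ∈ L) ∧ (∃ p ∈ B, p ∈ L)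

/-- The number of bichromatic lines determined by `R ∪ B`. -/
def nBichromatic (R B : Finset (ℝ × ℝ)) : ℕ :=
  {L : Set (ℝ × ℝ) | BichromaticLine R B L}.ncard

/-- A near-pencil: some line contains all but exactly one of the points of `P`. -/
def NearPencil (P : Finset (ℝ × ℝ)) : Prop :=
  ∃ L : Set (ℝ × ℝ), IsLine L ∧ (ptsOn P L).card = P.card - 1

section

open Polynomial Module

set_option maxSynthPendingDepth 10

theorem IsNonarchimedean.det_le {R : Type*} [CommRing R] [IsDomain R] {v : AbsoluteValue R ℝ}
    (hv : IsNonarchimedean v) {ι : Type*} [Fintype ι] [DecidableEq ι] (M : Matrix ι ι R)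
    (ρ κ : ι → ℝ) (h : ∀ i j, v (M i j) ≤ ρ i * κ j) :
    v M.det ≤ (∏ i, ρ i) * ∏ j, κ j := by
  rw [Matrix.det_apply']
  have hterm : ∀ σ : Equiv.Perm ι,
      v (((Equiv.Perm.sign σ : ℤ) : R) * ∏ i, M (σ i) i) ≤ (∏ i, ρ i) * ∏ j, κ j := by
    intro σ
    have hs : v ((Equiv.Perm.sign σ : ℤ) : R) ≤ 1 := hv.apply_intCast_le_one
    calc v (((Equiv.Perm.sign σ : ℤ) : R) * ∏ i, M (σ i) i)
        ≤ 1 * ∏ i, v (M (σ i) i) := by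
          rw [map_mul, map_prod]
          gcongr
      _ ≤ ∏ i, (ρ (σ i) * κ i) := by
          rw [one_mul]
          exact Finset.prod_le_prod (fun i _ => v.nonneg _) (fun i _ => h _ _)
      _ = (∏ i, ρ i) * ∏ j, κ j := by
          rw [Finset.prod_mul_distrib, Equiv.prod_comp σ ρ]
  obtain ⟨σ, _, hσ⟩ := hv.finset_image_add_of_nonempty
    (fun σ : Equiv.Perm ι => ((Equiv.Perm.sign σ : ℤ) : R) * ∏ i, M (σ i) i)
    (Finset.univ_nonempty)
  exact hσ.trans (hterm σ)

theorem prod_fin_pow_add (c : ℝ) (a b : ℕ) :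
    ∏ i : Fin (a + b), c ^ (i : ℕ)
      = (∏ i : Fin a, c ^ (i : ℕ)) * (∏ i : Fin b, c ^ (i : ℕ)) * c ^ (a * b) := by
  rw [Fin.prod_univ_add]
  simp [pow_add, Finset.prod_mul_distrib, pow_mul]
  ring

/-- The discriminant of `G` is bounded by its Gauss norm. -/
theorem Polynomial.discr_le_gaussNorm {R : Type*} [CommRing R] [IsDomain R] {v : AbsoluteValue R ℝ}
    (hv : IsNonarchimedean v) {c : ℝ} (hc : 0 < c) (G : R[X]) (hG : 2 ≤ G.natDegree) :
    v G.discr * c ^ (G.natDegree * (G.natDegree - 1))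
      ≤ G.gaussNorm v c ^ (2 * (G.natDegree - 1)) := by
  set s := G.gaussNorm v c with hs
  have hG0 : G ≠ 0 := by rintro rfl; simp at hG
  have hs0 : 0 < s := by
    refine lt_of_le_of_ne (G.gaussNorm_nonneg v hc.le) (Ne.symm ?_)
    rw [hs, Ne, gaussNorm_eq_zero_iff v G (fun x hx => by simpa using hx) hc]
    exact hG0
  have hco : ∀ j, v (G.coeff j) ≤ s / c ^ j := fun j => by
    rw [le_div_iff₀ (by positivity)]; exact G.le_gaussNorm v hc.le j
  have hnat : ∀ k : ℕ, v (k : R) ≤ 1 := fun k => hv.apply_natCast_le_one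
  have hdco : ∀ j, v (G.derivative.coeff j) ≤ s / c ^ (j + 1) := fun j => by
    rw [coeff_derivative, map_mul]
    have := hnat (j + 1)
    push_cast at this
    calc _ ≤ s / c ^ (j + 1) * 1 := by
          gcongr
          exact hco _
      _ = _ := mul_one _
  obtain ⟨B, hB⟩ : ∃ B, G.natDegree = B + 2 := ⟨G.natDegree - 2, by omega⟩
  let ρ : Fin (G.natDegree - 1 + G.natDegree) → ℝ := fun i =>
    (c ^ (i : ℕ))⁻¹ * (if (i : ℕ) = 2 * G.natDegree - 2 then c ^ G.natDegree / s else 1)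
  let κ : Fin (G.natDegree - 1 + G.natDegree) → ℝ := fun j =>
    j.addCases (fun j₁ => s * c ^ (j₁ : ℕ)) (fun j₁ => s * c ^ (j₁ : ℕ) * c⁻¹)
  have key : v G.sylvesterDeriv.det ≤ (∏ i, ρ i) * ∏ j, κ j := by
    apply hv.det_le
    intro i j
    rw [sylvesterDeriv, dif_neg (by omega), Matrix.updateRow_apply]
    have hκ : 0 ≤ κ j := by
      induction j using Fin.addCases <;> simp only [κ, Fin.addCases_left, Fin.addCases_right] <;>
        positivity
    have hρ : 0 ≤ ρ i := by
      simp only [ρ]; split_ifs <;> positivity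
    split_ifs with h1 h2 h3
    · subst h1
      have : j = Fin.castAdd _ ⟨G.natDegree - 2, by omega⟩ := by
        ext; simpa using h2
      rw [this]
      simp only [ρ, κ, Fin.addCases_left, if_true, map_one]
      rw [hB, show 2 * (B + 2) - 2 = (B + 2) + (B + 2 - 2) by omega, pow_add]
      apply le_of_eq; field_simp
    · subst h1
      have : j = Fin.natAdd _ ⟨G.natDegree - 1, by omega⟩ := by
        ext; simp; omega
      rw [this]
      simp only [ρ, κ, Fin.addCases_right, if_true]
      refine (hnat _).trans (le_of_eq ?_)
      rw [hB, show 2 * (B + 2) - 2 = (B + 2) + B by omega, show B + 2 - 1 = B + 1 by omega,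
        pow_add, pow_succ c B]
      field_simp
    · simpa using mul_nonneg hρ hκ
    · have hi : (i : ℕ) ≠ 2 * G.natDegree - 2 := fun h => h1 (Fin.ext h)
      simp only [sylvester, Matrix.of_apply]
      induction j using Fin.addCases with
      | left j =>
        simp only [Fin.addCases_left]
        split_ifs with h
        · refine (hco _).trans (le_of_eq ?_)
          simp only [ρ, κ, Fin.addCases_left, if_neg hi]
          obtain ⟨k, hk⟩ := Nat.exists_eq_add_of_le h.1
          rw [hk, Nat.add_sub_cancel_left, pow_add]
          field_simp
        · simpa using mul_nonneg hρ hκ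
      | right j =>
        simp only [Fin.addCases_right]
        split_ifs with h
        · refine (hdco _).trans (le_of_eq ?_)
          simp only [ρ, κ, Fin.addCases_right, if_neg hi]
          obtain ⟨k, hk⟩ := Nat.exists_eq_add_of_le h.1
          rw [hk, Nat.add_sub_cancel_left, pow_succ, pow_add]
          field_simp
        · simpa using mul_nonneg hρ hκ
  have hρprod : ∏ i, ρ i = (∏ i : Fin (G.natDegree - 1 + G.natDegree), c ^ (i : ℕ))⁻¹ *
      (c ^ G.natDegree / s) := by
    simp only [ρ, Finset.prod_mul_distrib, Finset.prod_inv_distrib]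
    congr 1
    rw [Finset.prod_eq_single (⟨2 * G.natDegree - 2, by omega⟩ :
      Fin (G.natDegree - 1 + G.natDegree))]
    · simp
    · intro b _ hb
      rw [if_neg (fun h => hb (Fin.ext h))]
    · simp
  have hκprod : ∏ j, κ j = s ^ (G.natDegree - 1) * (∏ i : Fin (G.natDegree - 1), c ^ (i : ℕ)) *
      (s ^ G.natDegree * (∏ i : Fin G.natDegree, c ^ (i : ℕ)) * (c⁻¹) ^ G.natDegree) := by
    simp only [κ, Fin.prod_univ_add, Fin.addCases_left, Fin.addCases_right,
      Finset.prod_mul_distrib, Finset.prod_const, Finset.card_univ, Fintype.card_fin]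
  have hd : v G.discr = v G.sylvesterDeriv.det := by
    rw [discr, map_mul, map_pow, v.map_neg, map_one, one_pow, mul_one]
  rw [hd]
  refine (mul_le_mul_of_nonneg_right key (by positivity)).trans (le_of_eq ?_)
  rw [hρprod, hκprod, prod_fin_pow_add]
  have h1 : 0 < ∏ i : Fin (G.natDegree - 1), c ^ (i : ℕ) := Finset.prod_pos fun _ _ => by positivity
  have h2 : 0 < ∏ i : Fin (G.natDegree), c ^ (i : ℕ) := Finset.prod_pos fun _ _ => by positivity
  generalize ∏ i : Fin (G.natDegree - 1), c ^ (i : ℕ) = p at *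
  generalize ∏ i : Fin (G.natDegree), c ^ (i : ℕ) = q at *
  rw [hB, show 2 * (B + 2 - 1) = 2 * B + 2 by omega, show B + 2 - 1 = B + 1 by omega,
    mul_comm (B + 1) (B + 2), show s ^ (B + 2) = s ^ (B + 1) * s by ring,
    show s ^ (2 * B + 2) = s ^ (B + 1) * s ^ (B + 1) by ring, inv_pow]
  field_simp

theorem Polynomial.discr_taylor {R : Type*} [CommRing R] [IsDomain R] [CharZero R] (G : R[X])
    (r : R) (hG : 0 < G.natDegree) : (taylor r G).discr = G.discr := by
  have h1 := resultant_deriv (natDegree_pos_iff_degree_pos.mp hG)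
  have h2 := resultant_deriv (f := taylor r G)
    (natDegree_pos_iff_degree_pos.mp (by rwa [natDegree_taylor]))
  have hd : (taylor r G).derivative = taylor r G.derivative := by
    simp [taylor_apply, derivative_comp]
  have hlc : (taylor r G).leadingCoeff = G.leadingCoeff := by
    simp
  have hnd : G.natDegree - 1 = G.derivative.natDegree := by
    rw [natDegree_derivative]
  have hlc0 : G.leadingCoeff ≠ 0 := by
    rw [Ne, leadingCoeff_eq_zero]; rintro rfl; simp at hG
  have h3 := resultant_taylor G G.derivative r
  rw [natDegree_taylor, natDegree_taylor] at h3
  rw [natDegree_taylor, hd, hlc, hnd, h3, ← hnd, h1] at h2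
  refine (mul_left_cancel₀ (mul_ne_zero (pow_ne_zero _ (by simp)) hlc0) h2).symm

theorem Polynomial.discr_ne_zero {R : Type*} [CommRing R] [IsDomain R] [CharZero R]
    [NormalizedGCDMonoid R] {G : R[X]} (hG : 0 < G.natDegree) (hirr : Irreducible G) :
    G.discr ≠ 0 := by
  have h1 := resultant_deriv (natDegree_pos_iff_degree_pos.mp hG)
  let K := FractionRing R
  have hprim : G.IsPrimitive := hirr.isPrimitive hG.ne'
  have hK : Irreducible (G.map (algebraMap R K)) :=
    (hprim.irreducible_iff_irreducible_map_fraction_map).mp hirr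
  have : CharZero K := charZero_of_injective_algebraMap (IsFractionRing.injective R K)
  have hsep : IsCoprime (G.map (algebraMap R K)) (derivative (G.map (algebraMap R K))) :=
    hK.separable
  have hres := resultant_ne_zero _ _ hsep
  rw [derivative_map, natDegree_map_eq_of_injective (IsFractionRing.injective R K),
    natDegree_map_eq_of_injective (IsFractionRing.injective R K), resultant_map_map,
    natDegree_derivative, h1] at hres
  intro h
  simp [h] at hres

/-- The absolute value on `ℝ[X]` given by the order of vanishing at `r`. -/
def rootAbs (r : ℝ) : AbsoluteValue ℝ[X] ℝ where
  toFun f := if f = 0 then 0 else (2⁻¹ : ℝ) ^ rootMultiplicity r f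
  map_mul' f g := by
    by_cases hf : f = 0
    · simp [hf]
    by_cases hg : g = 0
    · simp [hg]
    simp only [mul_eq_zero, hf, hg, or_self, if_false]
    rw [rootMultiplicity_mul (mul_ne_zero hf hg), pow_add]
  nonneg' f := by split_ifs <;> positivity
  eq_zero' f := by split_ifs <;> simp_all
  add_le' f g := by
    by_cases hf : f = 0
    · simp [hf]
    by_cases hg : g = 0
    · simp [hg]
    by_cases hfg : f + g = 0
    · simp only [hfg, hf, hg, if_true, if_false]; positivity
    simp only [hfg, hf, hg, if_false]
    have h := rootMultiplicity_add (p := f) (q := g) r hfg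
    rcases min_le_iff.mp h with h | h
    · exact (pow_le_pow_of_le_one (by norm_num) (by norm_num) h).trans
        (le_add_of_nonneg_right (by positivity))
    · exact (pow_le_pow_of_le_one (by norm_num) (by norm_num) h).trans
        (le_add_of_nonneg_left (by positivity))

theorem rootAbs_apply {f : ℝ[X]} (hf : f ≠ 0) (r : ℝ) :
    rootAbs r f = (2⁻¹ : ℝ) ^ rootMultiplicity r f := if_neg hf

theorem isNonarchimedean_rootAbs (r : ℝ) : IsNonarchimedean (rootAbs r) := by
  intro f g
  by_cases hf : f = 0
  · simp [hf]
  by_cases hg : g = 0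
  · simp [hg]
  by_cases hfg : f + g = 0
  · simp [hfg]
  rw [rootAbs_apply hf, rootAbs_apply hg, rootAbs_apply hfg, le_max_iff]
  exact (min_le_iff.mp (rootMultiplicity_add (p := f) (q := g) r hfg)).imp
    (fun h => pow_le_pow_of_le_one (by norm_num) (by norm_num) h)
    (fun h => pow_le_pow_of_le_one (by norm_num) (by norm_num) h)

theorem rootAbs_eq_one {f : ℝ[X]} {r : ℝ} (h : f.eval r ≠ 0) : rootAbs r f = 1 := by
  have hf : f ≠ 0 := by rintro rfl; simp at h
  rw [rootAbs_apply hf, rootMultiplicity_eq_zero h, pow_zero]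

theorem rootAbs_le_of_dvd {f : ℝ[X]} {r : ℝ} {e : ℕ} (h : (X - C r) ^ e ∣ f) :
    rootAbs r f ≤ (2⁻¹ : ℝ) ^ e := by
  by_cases hf : f = 0
  · simp [hf]
  rw [rootAbs_apply hf]
  exact pow_le_pow_of_le_one (by norm_num) (by norm_num) ((le_rootMultiplicity_iff hf).mpr h)

/-- The absolute value on `ℝ[X]` given by the degree. -/
def degAbs : AbsoluteValue ℝ[X] ℝ where
  toFun f := if f = 0 then 0 else (2 : ℝ) ^ natDegree f
  map_mul' f g := by
    by_cases hf : f = 0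
    · simp [hf]
    by_cases hg : g = 0
    · simp [hg]
    simp only [mul_eq_zero, hf, hg, or_self, if_false]
    rw [natDegree_mul hf hg, pow_add]
  nonneg' f := by split_ifs <;> positivity
  eq_zero' f := by split_ifs <;> simp_all
  add_le' f g := by
    by_cases hf : f = 0
    · simp [hf]
    by_cases hg : g = 0
    · simp [hg]
    by_cases hfg : f + g = 0
    · simp only [hfg, hf, hg, if_true, if_false]; positivity
    simp only [hfg, hf, hg, if_false]
    rcases le_max_iff.mp (natDegree_add_le f g) with h | h
    · exact (pow_le_pow_right₀ (by norm_num) h).trans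
        (le_add_of_nonneg_right (by positivity))
    · exact (pow_le_pow_right₀ (by norm_num) h).trans
        (le_add_of_nonneg_left (by positivity))

theorem degAbs_apply {f : ℝ[X]} (hf : f ≠ 0) : degAbs f = (2 : ℝ) ^ natDegree f := if_neg hf

theorem isNonarchimedean_degAbs : IsNonarchimedean degAbs := by
  intro f g
  by_cases hf : f = 0
  · simp [hf]
  by_cases hg : g = 0
  · simp [hg]
  by_cases hfg : f + g = 0
  · simp [hfg]
  rw [degAbs_apply hf, degAbs_apply hg, degAbs_apply hfg, le_max_iff]
  exact (le_max_iff.mp (natDegree_add_le f g)).imp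
    (fun h => pow_le_pow_right₀ (by norm_num) h)
    (fun h => pow_le_pow_right₀ (by norm_num) h)

theorem degAbs_le {f : ℝ[X]} {e : ℕ} (h : f.natDegree ≤ e) : degAbs f ≤ (2 : ℝ) ^ e := by
  by_cases hf : f = 0
  · simp [hf]
  rw [degAbs_apply hf]
  exact pow_le_pow_right₀ (by norm_num) h

theorem sum_rootMultiplicity_le {ι : Type*} [Fintype ι] {U : ι → ℝ} (hU : U.Injective)
    (f : ℝ[X]) : ∑ i, rootMultiplicity (U i) f ≤ f.natDegree := by
  calc ∑ i, rootMultiplicity (U i) f = ∑ a ∈ Finset.univ.image U, f.roots.count a := by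
        rw [Finset.sum_image (fun _ _ _ _ h => hU h)]
        simp
    _ ≤ ∑ a ∈ Finset.univ.image U ∪ f.roots.toFinset, f.roots.count a :=
        Finset.sum_le_sum_of_subset Finset.subset_union_left
    _ = Multiset.card f.roots := Multiset.sum_count_eq_card fun a ha => by simp_all
    _ ≤ _ := f.card_roots'

theorem one_le_prod_rootAbs {ι : Type*} [Fintype ι] {U : ι → ℝ} (hU : U.Injective)
    {f : ℝ[X]} (hf : f ≠ 0) : 1 ≤ (∏ i, rootAbs (U i) f) * degAbs f := by
  simp only [rootAbs_apply hf, degAbs_apply hf, Finset.prod_pow_eq_pow_sum]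
  rw [inv_pow, inv_mul_eq_div, one_le_div (by positivity)]
  exact pow_le_pow_right₀ (by norm_num) (sum_rootMultiplicity_le hU f)

/-- A multiplicative size of bivariate polynomials measuring vanishing at the points `(U i, X i)`
and the line `u = 0` against the degree. -/
def weightedSize {ι : Type*} [Fintype ι] (x U : ι → ℝ) (c : ℝ) (G : ℝ[X][X]) : ℝ :=
  (∏ i, (taylor (C (x i)) G).gaussNorm (rootAbs (U i)) c) * G.gaussNorm (rootAbs 0) 1 *
    G.gaussNorm degAbs 2⁻¹ * 4 ^ G.natDegree

section

variable {ι : Type*} [Fintype ι] {x U : ι → ℝ} {c : ℝ}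

theorem weightedSize_mul (hc : 0 < c) {G H : ℝ[X][X]} (hG : G ≠ 0) (hH : H ≠ 0) :
    weightedSize x U c (G * H) = weightedSize x U c G * weightedSize x U c H := by
  simp only [weightedSize]
  rw [gaussNorm_mul (isNonarchimedean_rootAbs 0) one_pos,
    gaussNorm_mul isNonarchimedean_degAbs (by norm_num), natDegree_mul hG hH, pow_add]
  have : ∀ i, (taylor (C (x i)) (G * H)).gaussNorm (rootAbs (U i)) c =
      (taylor (C (x i)) G).gaussNorm (rootAbs (U i)) c *
        (taylor (C (x i)) H).gaussNorm (rootAbs (U i)) c := fun i => by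
    rw [taylor_mul, gaussNorm_mul (isNonarchimedean_rootAbs _) hc]
  simp only [this, Finset.prod_mul_distrib]
  ring

theorem one_le_weightedSize_C (hU : U.Injective) (hU0 : ∀ i, U i ≠ 0) {f : ℝ[X]} (hf : f ≠ 0) :
    1 ≤ weightedSize x U c (C f) := by
  simp only [weightedSize, taylor_C, gaussNorm_C, natDegree_C, pow_zero, mul_one]
  have := one_le_prod_rootAbs (U := fun o : Option ι => o.elim 0 U) (f := f) (by
    rintro (_ | i) (_ | j) h
    · rfl
    · exact absurd h.symm (hU0 j)
    · exact absurd h (hU0 i)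
    · exact congrArg some (hU h)) hf
  rw [Fintype.prod_option] at this
  simp only [Option.elim] at this
  linarith

theorem Prime.exists_eval_coeff_ne_zero {G : ℝ[X][X]} (hG : Prime G) (hd : 0 < G.natDegree)
    (a : ℝ) : ∃ j, (G.coeff j).eval a ≠ 0 := by
  by_contra! h
  have hdvd : C (X - C a) ∣ G := (C_dvd_iff_dvd_coeff _ _).mpr fun j => dvd_iff_isRoot.mpr (h j)
  exact not_isUnit_X_sub_C a (hG.irreducible.isPrimitive hd.ne' _ hdvd)

theorem Prime.one_le_gaussNorm_rootAbs {G : ℝ[X][X]} (hG : Prime G) (hd : 0 < G.natDegree)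
    (a : ℝ) : 1 ≤ G.gaussNorm (rootAbs a) 1 := by
  obtain ⟨j, hj⟩ := hG.exists_eval_coeff_ne_zero hd a
  have := G.le_gaussNorm (rootAbs a) zero_le_one j
  rwa [rootAbs_eq_one hj, one_pow, one_mul] at this

theorem one_le_weightedSize_of_two_le (hc : 0 < c)
    (hcn : c ^ Fintype.card ι = 1 / 8) (hU : U.Injective) {G : ℝ[X][X]} (hG : Prime G)
    (hd : 2 ≤ G.natDegree) : 1 ≤ weightedSize x U c G := by
  have hD : G.discr ≠ 0 := discr_ne_zero (by omega) hG.irreducible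
  set B := G.natDegree with hB
  have h1 : ∀ i, rootAbs (U i) G.discr * c ^ (B * (B - 1)) ≤
      ((taylor (C (x i)) G).gaussNorm (rootAbs (U i)) c) ^ (2 * (B - 1)) := fun i => by
    have := discr_le_gaussNorm (isNonarchimedean_rootAbs (U i)) hc (taylor (C (x i)) G)
      (by rwa [natDegree_taylor])
    rwa [natDegree_taylor, discr_taylor _ _ (by omega)] at this
  have h2 := discr_le_gaussNorm isNonarchimedean_degAbs (c := 2⁻¹) (by norm_num) G hd
  have h3 := one_le_prod_rootAbs hU hD
  have h4 : (∏ i, rootAbs (U i) G.discr) * (1 / 8) ^ (B * (B - 1)) ≤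
      (∏ i, (taylor (C (x i)) G).gaussNorm (rootAbs (U i)) c) ^ (2 * (B - 1)) := by
    calc _ = ∏ i, (rootAbs (U i) G.discr * c ^ (B * (B - 1))) := by
          rw [Finset.prod_mul_distrib, Finset.prod_const, Finset.card_univ, ← hcn, ← pow_mul,
            ← pow_mul, mul_comm (B * (B - 1))]
      _ ≤ _ := by
          rw [← Finset.prod_pow]
          exact Finset.prod_le_prod (fun i _ => mul_nonneg ((rootAbs _).nonneg _) (by positivity))
            (fun i _ => h1 i)
  set p := ∏ i, (taylor (C (x i)) G).gaussNorm (rootAbs (U i)) c with hp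
  have hp0 : 0 ≤ p := Finset.prod_nonneg fun i _ => gaussNorm_nonneg _ _ hc.le
  have hs0 : 0 ≤ G.gaussNorm degAbs 2⁻¹ := gaussNorm_nonneg _ _ (by norm_num)
  have h5 : 1 ≤ (p * G.gaussNorm degAbs 2⁻¹ * 4 ^ B) ^ (2 * (B - 1)) := by
    have hmul := mul_le_mul h4 h2 (mul_nonneg (degAbs.nonneg _) (by positivity)) (by positivity)
    have e : ((4 : ℝ) ^ B) ^ (2 * (B - 1)) = 8 ^ (B * (B - 1)) * 2 ^ (B * (B - 1)) := by
      rw [← pow_mul, ← mul_pow, show B * (2 * (B - 1)) = 2 * (B * (B - 1)) by ring, pow_mul]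
      norm_num
    rw [mul_pow, mul_pow, e]
    have e8 : (0 : ℝ) < 8 ^ (B * (B - 1)) := by positivity
    have e2 : (0 : ℝ) < 2 ^ (B * (B - 1)) := by positivity
    rw [one_div, inv_pow, inv_pow] at hmul
    calc (1 : ℝ) ≤ (∏ i, rootAbs (U i) G.discr) * degAbs G.discr := h3
      _ = (∏ i, rootAbs (U i) G.discr) * (8 ^ (B * (B - 1)))⁻¹ *
          (degAbs G.discr * (2 ^ (B * (B - 1)))⁻¹) * (8 ^ (B * (B - 1)) * 2 ^ (B * (B - 1))) := by
          field_simp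
      _ ≤ _ := mul_le_mul_of_nonneg_right hmul (by positivity)
  have h6 : 1 ≤ p * G.gaussNorm degAbs 2⁻¹ * 4 ^ B := by
    by_contra! h
    exact absurd h5 (not_le.mpr (pow_lt_one₀ (by positivity) h (by omega)))
  have h7 := hG.one_le_gaussNorm_rootAbs (by omega) 0
  have h8 := one_le_mul_of_one_le_of_one_le h6 h7
  rw [weightedSize, ← hp, ← hB]
  linarith

theorem one_le_weightedSize_of_eq_one (hc : 0 < c) (hc1 : c ≤ 1)
    (hcn : c ^ Fintype.card ι = 1 / 8) (hx : ∀ i, x i ≠ 0)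
    (hcol : ∀ α β γ : ℝ, (β ≠ 0 ∨ γ ≠ 0) →
      3 * (Finset.univ.filter fun i => α + β * x i + γ * (U i * x i) = 0).card
        ≤ 2 * Fintype.card ι)
    {G : ℝ[X][X]} (hG : Prime G)
    (hd : G.natDegree = 1) : 1 ≤ weightedSize x U c G := by
  set p := G.coeff 1 with hp
  set q := G.coeff 0 with hq
  have hGe : G = C p * X + C q := eq_X_add_C_of_natDegree_le_one hd.le
  have hp0 : p ≠ 0 := by
    rw [hp, ← hd, coeff_natDegree, Ne, leadingCoeff_eq_zero]; exact hG.ne_zero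
  let g := fun i => (taylor (C (x i)) G).gaussNorm (rootAbs (U i)) c
  have ht : ∀ i, taylor (C (x i)) G = C p * X + C (q + p * C (x i)) := fun i => by
    rw [hGe]; simp; ring
  have hg1 : ∀ i, rootAbs (U i) p * c ≤ g i := fun i => by
    have := (taylor (C (x i)) G).le_gaussNorm (rootAbs (U i)) hc.le 1
    rw [ht i] at this
    simpa [g, ht i] using this
  have hg0 : ∀ i, rootAbs (U i) (q + p * C (x i)) ≤ g i := fun i => by
    have := (taylor (C (x i)) G).le_gaussNorm (rootAbs (U i)) hc.le 0
    rw [ht i] at this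
    simpa [g, ht i] using this
  have hgc : ∀ i, c ≤ g i := fun i => by
    by_cases h : p.eval (U i) = 0
    · refine hc1.trans (le_trans (le_of_eq ?_) (hg0 i))
      rw [rootAbs_eq_one]
      obtain ⟨j, hj⟩ := hG.exists_eval_coeff_ne_zero (by omega) (U i)
      have : q.eval (U i) ≠ 0 := by
        rcases j with _ | _ | j
        · exact hj
        · exact absurd h hj
        · rw [coeff_eq_zero_of_natDegree_lt (by omega)] at hj; simp at hj
      simpa [h] using this
    · have := hg1 i
      rwa [rootAbs_eq_one h, one_mul] at this
  have hgi : ∀ i, (q + p * C (x i)).eval (U i) ≠ 0 → 1 ≤ g i := fun i h => by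
    have := hg0 i
    rwa [rootAbs_eq_one h] at this
  have hs0 := hG.one_le_gaussNorm_rootAbs (by omega) 0
  have hi1 : degAbs p * 2⁻¹ ≤ G.gaussNorm degAbs 2⁻¹ := by
    simpa using G.le_gaussNorm degAbs (c := 2⁻¹) (by norm_num) 1
  have hi0 : degAbs q ≤ G.gaussNorm degAbs 2⁻¹ := by
    simpa using G.le_gaussNorm degAbs (c := 2⁻¹) (by norm_num) 0
  suffices h : ∃ a b : ℝ, 0 ≤ a ∧ 0 ≤ b ∧ a ≤ ∏ i, g i ∧ b ≤ G.gaussNorm degAbs 2⁻¹ ∧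
      1 / 4 ≤ a * b by
    obtain ⟨a, b, ha, hb, hag, hbg, hab⟩ := h
    rw [weightedSize, hd]
    have h1 := mul_le_mul hag hbg hb (ha.trans hag)
    have h2 := le_mul_of_one_le_right ((mul_nonneg ha hb).trans h1) hs0
    have h3 : ∏ i, (taylor (C (x i)) G).gaussNorm (rootAbs (U i)) c = ∏ i, g i := rfl
    rw [h3]
    linarith
  by_cases hdeg : p.natDegree ≤ 1 ∧ q.natDegree ≤ 0
  · obtain ⟨α, hα⟩ := natDegree_eq_zero.mp (Nat.le_zero.mp hdeg.2)
    obtain ⟨γ, β, hpe⟩ := exists_eq_X_add_C_of_natDegree_le_one hdeg.1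
    have hβγ : β ≠ 0 ∨ γ ≠ 0 := by
      by_contra! h
      exact hp0 (by rw [hpe, h.1, h.2]; simp)
    have hev : ∀ i, (q + p * C (x i)).eval (U i) = α + β * x i + γ * (U i * x i) := fun i => by
      rw [hpe, ← hα]; simp; ring
    let I := Finset.univ.filter fun i => α + β * x i + γ * (U i * x i) = 0
    have hI : 3 * I.card ≤ 2 * Fintype.card ι := hcol α β γ hβγ
    have hprod : c ^ I.card ≤ ∏ i, g i := by
      calc c ^ I.card = ∏ i, (if α + β * x i + γ * (U i * x i) = 0 then c else 1) := by
            rw [Finset.prod_ite]; simp [I]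
        _ ≤ _ := by
            refine Finset.prod_le_prod (fun i _ => by split_ifs <;> positivity) fun i _ => ?_
            split_ifs with h
            · exact hgc i
            · exact hgi i (by rwa [hev])
    by_cases hq0 : q = 0 ∧ γ = 0
    · have hα0 : α = 0 := by rw [hq0.1] at hα; simpa using hα
      have hβ0 : β ≠ 0 := hβγ.resolve_right (by simp [hq0.2])
      have hI0 : I = ∅ := by
        simp [I, hα0, hq0.2, hβ0, hx]
      rw [hI0] at hprod
      refine ⟨1, 2⁻¹, by norm_num, by norm_num, by simpa using hprod, ?_, by norm_num⟩
      refine le_trans ?_ hi1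
      rw [degAbs_apply hp0]
      have : (1 : ℝ) ≤ 2 ^ p.natDegree := one_le_pow₀ (by norm_num)
      linarith
    · refine ⟨c ^ I.card, 1, by positivity, by norm_num, hprod, ?_, ?_⟩
      · by_cases hq00 : q = 0
        · have hγ : γ ≠ 0 := fun h => hq0 ⟨hq00, h⟩
          refine le_trans ?_ hi1
          rw [degAbs_apply hp0, hpe, natDegree_linear hγ]
          norm_num
        · refine le_trans ?_ hi0
          rw [degAbs_apply hq00]
          exact one_le_pow₀ (by norm_num)
      · rw [mul_one]
        by_contra! h
        have h1 : (c ^ I.card) ^ 3 < (1 / 4) ^ 3 := by gcongr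
        have h2 : c ^ (2 * Fintype.card ι) ≤ c ^ (I.card * 3) :=
          pow_le_pow_of_le_one hc.le hc1 (by omega)
        rw [mul_comm 2, pow_mul, hcn, pow_mul] at h2
        norm_num at h1 h2
        linarith
  · refine ⟨1 / 8, 2, by norm_num, by norm_num, ?_, ?_, by norm_num⟩
    · rw [← hcn, ← Finset.card_univ, ← Finset.prod_const]
      exact Finset.prod_le_prod (fun _ _ => hc.le) fun i _ => hgc i
    · rw [not_and_or, not_le, not_le] at hdeg
      rcases hdeg with h | h
      · refine le_trans ?_ hi1
        rw [degAbs_apply hp0]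
        have : (2 : ℝ) ^ 2 ≤ 2 ^ p.natDegree := pow_le_pow_right₀ (by norm_num) h
        linarith
      · refine le_trans ?_ hi0
        rw [degAbs_apply (by rintro h0; simp [h0] at h)]
        have : (2 : ℝ) ^ 1 ≤ 2 ^ q.natDegree := pow_le_pow_right₀ (by norm_num) h
        linarith

theorem one_le_weightedSize (hc : 0 < c) (hc1 : c ≤ 1)
    (hcn : c ^ Fintype.card ι = 1 / 8) (hU : U.Injective) (hU0 : ∀ i, U i ≠ 0)
    (hx : ∀ i, x i ≠ 0)
    (hcol : ∀ α β γ : ℝ, (β ≠ 0 ∨ γ ≠ 0) →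
      3 * (Finset.univ.filter fun i => α + β * x i + γ * (U i * x i) = 0).card
        ≤ 2 * Fintype.card ι)
    {G : ℝ[X][X]} (hG : G ≠ 0) : 1 ≤ weightedSize x U c G := by
  have hconst : ∀ G : ℝ[X][X], G ≠ 0 → G.natDegree = 0 → 1 ≤ weightedSize x U c G := by
    intro G hG h
    obtain ⟨f, rfl⟩ := natDegree_eq_zero.mp h
    exact one_le_weightedSize_C hU hU0 (by rintro rfl; simp at hG)
  revert hG
  refine UniqueFactorizationMonoid.induction_on_prime
    (P := fun G : ℝ[X][X] => G ≠ 0 → 1 ≤ weightedSize x U c G) G (fun h => absurd rfl h) ?_ ?_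
  · exact fun G hG h => hconst G h (natDegree_eq_zero_of_isUnit hG)
  · intro G p hG hp ih _
    rw [weightedSize_mul hc hp.ne_zero hG]
    refine one_le_mul_of_one_le_of_one_le ?_ (ih hG)
    rcases Nat.lt_trichotomy p.natDegree 1 with h | h | h
    · exact hconst p hp.ne_zero (by omega)
    · exact one_le_weightedSize_of_eq_one hc hc1 hcn hx hcol hp h
    · exact one_le_weightedSize_of_two_le hc hcn hU hp h

end

theorem Submodule.finrank_map_add_finrank_inf_ker {V V' : Type*} [AddCommGroup V] [Module ℝ V]
    [AddCommGroup V'] [Module ℝ V'] (L : V →ₗ[ℝ] V') (W : Submodule ℝ V) [FiniteDimensional ℝ W] :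
    finrank ℝ (W.map L) + finrank ℝ (W ⊓ LinearMap.ker L : Submodule ℝ V) = finrank ℝ W := by
  rw [← (L.domRestrict W).finrank_range_add_finrank_ker, LinearMap.range_domRestrict,
    LinearMap.ker_domRestrict]
  congr 1
  rw [← finrank_map_subtype_eq W, Submodule.map_comap_subtype]

/-- Imposing finitely many vector-valued linear conditions. -/
theorem Submodule.finrank_le_inf_iInf_ker {V κ : Type*} [AddCommGroup V] [Module ℝ V]
    {V' : Type*} [AddCommGroup V'] [Module ℝ V'] (L : κ → V →ₗ[ℝ] V')
    (W : Submodule ℝ V) [FiniteDimensional ℝ W] (s : Finset κ) (S : κ → Submodule ℝ V')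
    (d : κ → ℕ) (hS : ∀ k ∈ s, ∀ F ∈ W, L k F ∈ S k) [∀ k, FiniteDimensional ℝ (S k)]
    (hd : ∀ k ∈ s, finrank ℝ (S k) ≤ d k) :
    finrank ℝ W ≤ finrank ℝ (W ⊓ ⨅ k ∈ s, LinearMap.ker (L k) : Submodule ℝ V)
      + ∑ k ∈ s, d k := by
  induction s using Finset.induction_on with
  | empty =>
    have : ⨅ k ∈ (∅ : Finset κ), LinearMap.ker (L k) = ⊤ := by simp
    rw [this, inf_top_eq, Finset.sum_empty, add_zero]
  | insert a s ha ih =>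
    have ih := ih (fun k hk => hS k (Finset.mem_insert_of_mem hk))
      (fun k hk => hd k (Finset.mem_insert_of_mem hk))
    rw [Finset.sum_insert ha, Finset.iInf_insert]
    set Z := W ⊓ ⨅ k ∈ s, LinearMap.ker (L k)
    have hfin : FiniteDimensional ℝ Z := Submodule.finiteDimensional_inf_left _ _
    have h1 := Submodule.finrank_map_add_finrank_inf_ker (L a) Z
    have h2 : finrank ℝ (Z.map (L a)) ≤ d a := by
      refine (Submodule.finrank_mono ?_).trans (hd a (Finset.mem_insert_self _ _))
      rintro _ ⟨F, hF, rfl⟩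
      exact hS a (Finset.mem_insert_self _ _) F hF.1
    have h3 : W ⊓ (LinearMap.ker (L a) ⊓ ⨅ k ∈ s, LinearMap.ker (L k)) =
        Z ⊓ LinearMap.ker (L a) := by
      rw [inf_assoc, inf_comm (LinearMap.ker (L a))]
    rw [h3]
    omega

/-- The monomial-like polynomial `u ^ α * v ^ β * x ^ γ * (v + u * x) ^ δ`, where `x` is the
outermost variable and `u` the innermost one. -/
def flagMonomial (α β γ δ : ℕ) : ℝ[X][X][X] :=
  C (C X) ^ α * C X ^ β * X ^ γ * (C X + C (C X) * X) ^ δ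

/-- Functions of bidegree at most `(A, B)` on the variety of pairs of a line `Y = u * X + v` and a
marked point on it with abscissa `x`. -/
def flagSpace (A B : ℕ) : Submodule ℝ ℝ[X][X][X] :=
  Submodule.span ℝ {F | ∃ α β γ δ : ℕ, α + β ≤ A ∧ γ + δ ≤ B ∧ flagMonomial α β γ δ = F}

theorem flagMonomial_mem {A B α β γ δ : ℕ} (h : α + β ≤ A) (h' : γ + δ ≤ B) :
    flagMonomial α β γ δ ∈ flagSpace A B :=
  Submodule.subset_span ⟨α, β, γ, δ, h, h', rfl⟩

instance (A B : ℕ) : FiniteDimensional ℝ (flagSpace A B) := by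
  refine FiniteDimensional.span_of_finite ℝ (Set.Finite.subset
    (Set.finite_range fun p : Fin (A + 1) × Fin (A + 1) × Fin (B + 1) × Fin (B + 1) =>
      flagMonomial p.1 p.2.1 p.2.2.1 p.2.2.2) ?_)
  rintro _ ⟨α, β, γ, δ, h, h', rfl⟩
  exact ⟨(⟨α, by omega⟩, ⟨β, by omega⟩, ⟨γ, by omega⟩, ⟨δ, by omega⟩), rfl⟩

theorem flagMonomial_map (α γ δ : ℕ) :
    (flagMonomial α 0 γ δ).map (constantCoeff (R := ℝ[X])) =
      monomial (γ + δ) (X ^ (α + δ)) := by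
  simp only [flagMonomial, Polynomial.map_mul, Polynomial.map_pow, Polynomial.map_add,
    Polynomial.map_C, Polynomial.map_X, constantCoeff_apply, coeff_C_zero, coeff_X_zero,
    pow_zero, mul_one, map_zero, zero_add]
  rw [← C_mul_X_pow_eq_monomial, pow_add, mul_pow, map_mul, map_pow, map_pow]
  ring

/-- The coefficients of `u ^ r * x ^ j` in the restriction to `v = 0`. -/
def boundaryCoeffs (A B : ℕ) :
    ℝ[X][X][X] →ₗ[ℝ] ((Σ j : Fin (B + 1), Fin (A + j + 1)) → ℝ) where
  toFun F p := ((F.coeff p.1).coeff 0).coeff p.2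
  map_add' F G := by ext; simp
  map_smul' c F := by ext; simp

theorem boundaryCoeffs_apply {A B : ℕ} (F : ℝ[X][X][X])
    (p : Σ j : Fin (B + 1), Fin (A + j + 1)) :
    boundaryCoeffs A B F p = ((F.coeff p.1).coeff 0).coeff p.2 := rfl

theorem map_boundaryCoeffs (A B : ℕ) : (flagSpace A B).map (boundaryCoeffs A B) = ⊤ := by
  rw [eq_top_iff, ← (Pi.basisFun ℝ _).span_eq, Submodule.span_le]
  rintro _ ⟨⟨j, r⟩, rfl⟩
  refine ⟨flagMonomial (r - min (j : ℕ) r) 0 (j - min (j : ℕ) r) (min (j : ℕ) r),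
    flagMonomial_mem ?_ ?_, ?_⟩
  · have := r.2
    omega
  · have := j.2
    omega
  · ext ⟨j', r'⟩
    have := flagMonomial_map (r - min (j : ℕ) r) (j - min (j : ℕ) r) (min (j : ℕ) r)
    rw [Nat.sub_add_cancel (min_le_left _ _), Nat.sub_add_cancel (min_le_right _ _)] at this
    have h2 := congrArg (fun P => (P.coeff (j' : ℕ)).coeff (r' : ℕ)) this
    simp only [coeff_map, constantCoeff_apply] at h2
    rw [boundaryCoeffs_apply, h2, coeff_monomial, Pi.basisFun_apply, Pi.single_apply]
    by_cases hj : j = j'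
    · subst hj
      simp [coeff_X_pow, Fin.ext_iff, eq_comm]
    · have hj' : (j : ℕ) ≠ j' := fun h => hj (Fin.ext h)
      rw [if_neg hj', if_neg (by rintro ⟨⟩; exact hj rfl), coeff_zero]

theorem card_boundary (A B : ℕ) :
    2 * Fintype.card (Σ j : Fin (B + 1), Fin (A + j + 1)) = (B + 1) * (2 * A + B + 2) := by
  rw [Fintype.card_sigma]
  simp only [Fintype.card_fin]
  rw [Fin.sum_univ_eq_sum_range (fun j => A + j + 1)]
  induction B with
  | zero => simp; ring
  | succ B ih => rw [Finset.sum_range_succ, mul_add, ih]; ring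

theorem finrank_flagSpace (A B : ℕ) :
    (A + 1) * (B + 1) * (A + B + 2) ≤ 2 * finrank ℝ (flagSpace A B) := by
  have hcard := card_boundary A B
  have h1 := Submodule.finrank_map_add_finrank_inf_ker (boundaryCoeffs A B) (flagSpace A B)
  rw [map_boundaryCoeffs, finrank_top, Module.finrank_fintype_fun_eq_card] at h1
  induction A with
  | zero =>
    have : (0 + 1) * (B + 1) * (0 + B + 2) = (B + 1) * (2 * 0 + B + 2) := by ring
    omega
  | succ A ih =>
    have ih := ih (card_boundary A B) (by
      have := Submodule.finrank_map_add_finrank_inf_ker (boundaryCoeffs A B) (flagSpace A B)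
      rwa [map_boundaryCoeffs, finrank_top, Module.finrank_fintype_fun_eq_card] at this)
    let m : ℝ[X][X][X] →ₗ[ℝ] ℝ[X][X][X] := LinearMap.mulLeft ℝ (C X)
    have hm : Function.Injective m :=
      mul_right_injective₀ (C_ne_zero.mpr X_ne_zero)
    have h2 : finrank ℝ ((flagSpace A B).map m) = finrank ℝ (flagSpace A B) :=
      (Submodule.equivMapOfInjective m hm _).finrank_eq.symm
    have h3 : (flagSpace A B).map m ≤
        flagSpace (A + 1) B ⊓ LinearMap.ker (boundaryCoeffs (A + 1) B) := by
      refine le_inf ?_ ?_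
      · rw [flagSpace, Submodule.map_span, Submodule.span_le]
        rintro _ ⟨_, ⟨α, β, γ, δ, h, h', rfl⟩, rfl⟩
        have : m (flagMonomial α β γ δ) = flagMonomial α (β + 1) γ δ := by
          simp only [m, LinearMap.mulLeft_apply, flagMonomial, pow_succ]; ring
        rw [this]
        exact flagMonomial_mem (by omega) h'
      · rintro _ ⟨F, _, rfl⟩
        rw [LinearMap.mem_ker]
        ext ⟨j, r⟩
        simp [m, boundaryCoeffs]
    have hfin : FiniteDimensional ℝ
        (flagSpace (A + 1) B ⊓ LinearMap.ker (boundaryCoeffs (A + 1) B) : Submodule ℝ _) :=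
      Submodule.finiteDimensional_inf_left _ _
    have h4 := Submodule.finrank_mono h3
    rw [h2] at h4
    have e : (A + 1 + 1) * (B + 1) * (A + 1 + B + 2) =
        (A + 1) * (B + 1) * (A + B + 2) + (B + 1) * (2 * (A + 1) + B + 2) := by ring
    omega

theorem natDegree_mul_coeff_coeff_le {A A' : ℕ} {P Q : ℝ[X][X][X]}
    (hP : ∀ k l, ((P.coeff k).coeff l).natDegree ≤ A)
    (hQ : ∀ k l, ((Q.coeff k).coeff l).natDegree ≤ A') (k l : ℕ) :
    (((P * Q).coeff k).coeff l).natDegree ≤ A + A' := by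
  rw [coeff_mul, finsetSum_coeff]
  refine natDegree_sum_le_of_forall_le _ _ fun p _ => ?_
  rw [coeff_mul]
  exact natDegree_sum_le_of_forall_le _ _ fun q _ => natDegree_mul_le_of_le (hP _ _) (hQ _ _)

/-- Polynomials all of whose coefficients have degree at most `A` in the innermost variable. -/
def coeffDegreeLE (A : ℕ) : Submodule ℝ ℝ[X][X][X] where
  carrier := {P | ∀ k l, ((P.coeff k).coeff l).natDegree ≤ A}
  add_mem' hP hQ k l := by
    rw [coeff_add, coeff_add]
    exact natDegree_add_le_of_degree_le (hP k l) (hQ k l)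
  zero_mem' k l := by simp
  smul_mem' c P hP k l := by
    rw [coeff_smul, coeff_smul]
    exact (natDegree_smul_le _ _).trans (hP k l)

theorem mul_mem_coeffDegreeLE {A A' : ℕ} {P Q : ℝ[X][X][X]} (hP : P ∈ coeffDegreeLE A)
    (hQ : Q ∈ coeffDegreeLE A') : P * Q ∈ coeffDegreeLE (A + A') :=
  natDegree_mul_coeff_coeff_le hP hQ

theorem pow_mem_coeffDegreeLE {A : ℕ} {P : ℝ[X][X][X]} (hP : P ∈ coeffDegreeLE A) (n : ℕ) :
    P ^ n ∈ coeffDegreeLE (n * A) := by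
  induction n with
  | zero =>
    intro k l
    simp only [pow_zero, coeff_one, apply_ite (fun p : ℝ[X][X] => p.coeff l), coeff_zero]
    split_ifs <;> simp
  | succ n ih =>
    rw [pow_succ, Nat.succ_mul]
    exact mul_mem_coeffDegreeLE ih hP

theorem coeffDegreeLE_mono {A A' : ℕ} (h : A ≤ A') : coeffDegreeLE A ≤ coeffDegreeLE A' :=
  fun _ hP k l => (hP k l).trans h

theorem C_C_mem_coeffDegreeLE {A : ℕ} {f : ℝ[X]} (hf : f.natDegree ≤ A) :
    C (C f) ∈ coeffDegreeLE A := by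
  intro k l
  rw [coeff_C]
  split_ifs
  · rw [coeff_C]
    split_ifs
    · exact hf
    · simp
  · simp

theorem C_X_mem_coeffDegreeLE {A : ℕ} : (C X : ℝ[X][X][X]) ∈ coeffDegreeLE A := by
  intro k l
  rw [coeff_C]
  split_ifs
  · rw [coeff_X]
    split_ifs <;> simp
  · simp

theorem X_mem_coeffDegreeLE {A : ℕ} : (X : ℝ[X][X][X]) ∈ coeffDegreeLE A := by
  intro k l
  rw [coeff_X]
  split_ifs
  · rw [coeff_one]
    split_ifs <;> simp
  · simp

/-- Recentering at the point `(x, y)`: `v` is replaced by `v + y - u * x` and the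
outermost variable `t` by `t + x`. -/
def center (x y : ℝ) : ℝ[X][X][X] →ₐ[ℝ] ℝ[X][X][X] :=
  (mapAlgHom ((taylorAlgHom (C y - C x * X)).restrictScalars ℝ)).comp
    ((taylorAlgHom (C (C x))).restrictScalars ℝ)

theorem coeff_center (x y : ℝ) (F : ℝ[X][X][X]) (j : ℕ) :
    (center x y F).coeff j = taylor (C y - C x * X) ((taylor (C (C x)) F).coeff j) := by
  change ((taylor (C (C x)) F).map _).coeff j = _
  rw [coeff_map]
  rfl

/-- The coefficient of `v ^ e * x ^ j` after recentering at `(x, y)`. -/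
def pointCoeff (x y : ℝ) (e j : ℕ) : ℝ[X][X][X] →ₗ[ℝ] ℝ[X] where
  toFun F := ((center x y F).coeff j).coeff e
  map_add' F G := by simp
  map_smul' c F := by simp

theorem pointCoeff_apply (x y : ℝ) (e j : ℕ) (F : ℝ[X][X][X]) :
    pointCoeff x y e j F = ((center x y F).coeff j).coeff e := rfl

theorem center_C_C_X (x y : ℝ) : center x y (C (C X)) = C (C X) := by
  change (taylor _ (C (C X))).map _ = _
  rw [taylor_C, map_C]
  change C (taylor _ (C X)) = _
  rw [taylor_C]

theorem center_C_X (x y : ℝ) : center x y (C X) = C X + C (C (C y - C x * X)) := by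
  change (taylor _ (C X)).map _ = _
  rw [taylor_C, map_C]
  change C (taylor _ X) = _
  rw [taylor_X, C_add]

theorem center_X (x y : ℝ) : center x y X = X + C (C (C x)) := by
  change (taylor _ X).map _ = _
  rw [taylor_X, Polynomial.map_add, Polynomial.map_X, map_C]
  change X + C (taylor _ (C (C x))) = _
  rw [taylor_C]

theorem center_flagMonomial (x y : ℝ) (α β γ δ : ℕ) :
    center x y (flagMonomial α β γ δ) =
      C (C X) ^ α * (C X + C (C (C y - C x * X))) ^ β * (X + C (C (C x))) ^ γ *
        (C X + C (C (C y)) + C (C X) * X) ^ δ := by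
  have e : C X + C (C (C y - C x * X)) + C (C X) * (X + C (C (C x))) =
      (C X + C (C (C y)) + C (C X) * X : ℝ[X][X][X]) := by
    rw [C_sub (a := C y), C_sub (a := C (C y)), C_mul (a := C x), C_mul (a := C (C x))]
    ring
  rw [← e, flagMonomial, map_mul, map_mul, map_mul, map_pow, map_pow, map_pow, map_pow, map_add,
    map_mul, center_C_C_X, center_C_X, center_X]

/-- The substitution `v ↦ (Y - u) * T`, `x ↦ T`. -/
def blowUp : ℝ[X][X][X] →+* ℝ[X][X][X] :=
  eval₂RingHom (eval₂RingHom (C.comp C) (C (X - C X) * X)) X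

theorem coeff_blowUp (P : ℝ[X][X][X]) (d : ℕ) :
    (blowUp P).coeff d =
      taylor (-X) (∑ e ∈ Finset.range (d + 1), monomial e ((P.coeff (d - e)).coeff e)) := by
  induction P using Polynomial.induction_on' with
  | add P Q hP hQ => simp only [map_add, coeff_add, hP, hQ, Finset.sum_add_distrib]
  | monomial j f =>
    induction f using Polynomial.induction_on' with
    | add f g hf hg =>
      simp only [map_add, coeff_add, hf, hg, Finset.sum_add_distrib]
    | monomial e g =>
      have h1 : blowUp (monomial j (monomial e g)) = C (C g * (X - C X) ^ e) * X ^ (e + j) := by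
        simp only [blowUp, coe_eval₂RingHom, eval₂_monomial, RingHom.comp_apply]
        rw [map_mul, map_pow]
        ring
      rw [h1, coeff_C_mul, coeff_X_pow]
      split_ifs with h
      · rw [mul_one, Finset.sum_eq_single e]
        · rw [h, show e + j - e = j by omega, coeff_monomial, if_pos rfl, coeff_monomial,
            if_pos rfl, taylor_monomial, map_neg, ← sub_eq_add_neg]
        · intro e' _ he'
          rw [coeff_monomial]
          split_ifs
          · rw [coeff_monomial, if_neg (Ne.symm he'), map_zero]
          · simp
        · intro h2
          exact absurd (Finset.mem_range.mpr (by omega)) h2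
      · rw [mul_zero, Finset.sum_eq_zero, map_zero]
        intro e' he'
        rw [Finset.mem_range] at he'
        rw [coeff_monomial]
        split_ifs with h2
        · rw [coeff_monomial, if_neg (by omega), map_zero]
        · simp

theorem blowUp_center_mem (x y : ℝ) {A B : ℕ} {F : ℝ[X][X][X]} (hF : F ∈ flagSpace A B) :
    blowUp (center x y F) ∈ coeffDegreeLE A := by
  induction hF using Submodule.span_induction with
  | zero => simp
  | add F G _ _ hF hG => rw [map_add, map_add]; exact add_mem hF hG
  | smul c F _ hF =>
    have : blowUp (center x y (c • F)) = c • blowUp (center x y F) := by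
      rw [map_smul, Algebra.smul_def, Algebra.smul_def, map_mul]
      congr 1
      simp [blowUp, Polynomial.algebraMap_apply]
    rw [this]
    exact Submodule.smul_mem _ c hF
  | mem F h =>
    obtain ⟨α, β, γ, δ, h, h', rfl⟩ := h
    have b1 : blowUp (C (C X)) = C (C X) := by simp [blowUp]
    have b2 : blowUp (C X) = C (X - C X) * X := by simp [blowUp]
    have b3 : blowUp X = X := by simp [blowUp]
    have b4 : ∀ f : ℝ[X], blowUp (C (C f)) = C (C f) := fun f => by simp [blowUp]
    rw [center_flagMonomial]
    simp only [map_mul, map_pow, map_add blowUp, b1, b2, b3, b4]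
    have e : C (X - C X) * X + C (C (C y)) + C (C X) * X =
        (C X * X + C (C (C y)) : ℝ[X][X][X]) := by
      rw [map_sub]; ring
    rw [e]
    have m1 : C (C X) ∈ coeffDegreeLE 1 := C_C_mem_coeffDegreeLE natDegree_X_le
    have m2 : C (X - C X) * X + C (C (C y - C x * X)) ∈ coeffDegreeLE 1 := by
      refine add_mem ?_ (C_C_mem_coeffDegreeLE (by compute_degree))
      refine mul_mem_coeffDegreeLE (A := 1) (A' := 0) ?_ X_mem_coeffDegreeLE
      rw [map_sub]
      exact sub_mem C_X_mem_coeffDegreeLE m1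
    have m3 : X + C (C (C x)) ∈ coeffDegreeLE 0 :=
      add_mem X_mem_coeffDegreeLE (C_C_mem_coeffDegreeLE (by simp))
    have m4 : C X * X + C (C (C y)) ∈ coeffDegreeLE 0 :=
      add_mem (mul_mem_coeffDegreeLE (A := 0) (A' := 0) C_X_mem_coeffDegreeLE X_mem_coeffDegreeLE)
        (C_C_mem_coeffDegreeLE (by simp))
    refine coeffDegreeLE_mono ?_ (mul_mem_coeffDegreeLE (mul_mem_coeffDegreeLE
      (mul_mem_coeffDegreeLE (pow_mem_coeffDegreeLE m1 α) (pow_mem_coeffDegreeLE m2 β))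
      (pow_mem_coeffDegreeLE m3 γ)) (pow_mem_coeffDegreeLE m4 δ))
    omega

theorem natDegree_le_of_natDegree_X_mul_le {g : ℝ[X]} {A : ℕ}
    (h : (X * g).natDegree ≤ A + 1) : g.natDegree ≤ A := by
  by_cases hg : g = 0
  · simp [hg]
  · rw [natDegree_X_mul hg] at h
    omega

theorem natDegree_coeff_le_of_X_sub_C_X_mul {A : ℕ} {q : ℝ[X][X]}
    (h : ∀ k, (((X - C X) * q).coeff k).natDegree ≤ A + 1) (k : ℕ) :
    (q.coeff k).natDegree ≤ A := by
  apply natDegree_le_of_natDegree_X_mul_le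
  induction k with
  | zero =>
    have := h 0
    rwa [mul_coeff_zero, coeff_sub, coeff_X_zero, coeff_C_zero, zero_sub, neg_mul,
      natDegree_neg] at this
  | succ k ih =>
    have h1 := h (k + 1)
    rw [coeff_X_sub_C_mul] at h1
    have h2 : X * q.coeff (k + 1) =
        q.coeff k - (q.coeff k - X * q.coeff (k + 1)) := by ring
    rw [h2]
    exact natDegree_sub_le_of_le
      ((natDegree_le_of_natDegree_X_mul_le ih).trans (Nat.le_succ _)) h1 |>.trans (by simp)

theorem natDegree_coeff_le_of_X_sub_C_X_pow_mul {A e : ℕ} {q : ℝ[X][X]}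
    (h : ∀ k, (((X - C X) ^ e * q).coeff k).natDegree ≤ A + e) (k : ℕ) :
    (q.coeff k).natDegree ≤ A := by
  induction e with
  | zero => simpa using h k
  | succ e ih =>
    refine ih fun k => natDegree_coeff_le_of_X_sub_C_X_mul (fun k => ?_) k
    rw [← mul_assoc, ← pow_succ']
    exact h k

theorem natDegree_pointCoeff_le (x y : ℝ) {A B e j : ℕ} {F : ℝ[X][X][X]}
    (hF : F ∈ flagSpace A B) (he : e ≤ A)
    (h0 : ∀ e' j', e' < e → e' + j' = e + j → pointCoeff x y e' j' F = 0) :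
    (pointCoeff x y e j F).natDegree ≤ A - e + j := by
  have hH := blowUp_center_mem x y hF (e + j)
  rw [coeff_blowUp] at hH
  set Φ : ℝ[X][X] := ∑ e' ∈ Finset.range (e + j + 1),
    monomial e' (((center x y F).coeff (e + j - e')).coeff e') with hΦ
  have hcoeff : ∀ k, k ≤ e + j → Φ.coeff k = pointCoeff x y k (e + j - k) F := by
    intro k hk
    rw [hΦ, finsetSum_coeff, Finset.sum_eq_single k]
    · rw [coeff_monomial, if_pos rfl]; rfl
    · intro b _ hb
      rw [coeff_monomial, if_neg hb]
    · intro h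
      exact absurd (Finset.mem_range.mpr (by omega)) h
  have hdeg : Φ.natDegree ≤ e + j := by
    refine natDegree_sum_le_of_forall_le _ _ fun k hk => (natDegree_monomial_le _).trans ?_
    rw [Finset.mem_range] at hk
    omega
  obtain ⟨q, hq⟩ : X ^ e ∣ Φ := X_pow_dvd_iff.mpr fun d hd => by
    rw [hcoeff d (by omega)]
    exact h0 _ _ hd (by omega)
  have hq0 : pointCoeff x y e j F = (taylor (-X) q).eval X := by
    rw [taylor_eval, add_neg_cancel, ← coeff_zero_eq_eval_zero]
    have := hcoeff e (by omega)
    rw [hq, coeff_X_pow_mul', if_pos le_rfl, Nat.sub_self, show e + j - e = j by omega] at this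
    exact this.symm
  have hqdeg : q.natDegree ≤ j := by
    by_cases h : q = 0
    · simp [h]
    rw [hq, natDegree_mul (pow_ne_zero _ X_ne_zero) h, natDegree_X_pow] at hdeg
    omega
  have hqc : ∀ k, ((taylor (-X) q).coeff k).natDegree ≤ A - e := by
    apply natDegree_coeff_le_of_X_sub_C_X_pow_mul (e := e)
    intro k
    have := hH k
    rw [hq, taylor_mul, taylor_pow, taylor_X, map_neg, ← sub_eq_add_neg] at this
    rwa [Nat.sub_add_cancel he]
  rw [hq0, eval_eq_sum_range]
  refine natDegree_sum_le_of_forall_le _ _ fun k hk => natDegree_mul_le_of_le (hqc k) ?_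
  rw [natDegree_X_pow]
  rw [Finset.mem_range, natDegree_taylor] at hk
  omega

theorem Polynomial.coeff_taylor_eq_sum {R : Type*} [CommRing R] (r : R) (f : R[X]) (e : ℕ) :
    (taylor r f).coeff e =
      ∑ i ∈ f.support, (i.choose e : R) * f.coeff i * r ^ (i - e) := by
  rw [taylor_coeff, hasseDeriv_apply, Polynomial.sum, eval_finsetSum]
  simp only [eval_monomial]

/-- Polynomials in `v` and `u` vanishing to order at least `M` at `u = a`, `v = b`. -/
def vanishing (a b : ℝ) (M : ℕ) : Submodule ℝ ℝ[X][X] where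
  carrier := {f | ∀ e, (X - C a) ^ (M - e) ∣ (taylor (C b) f).coeff e}
  add_mem' hf hg e := by
    rw [map_add, coeff_add]
    exact dvd_add (hf e) (hg e)
  zero_mem' e := by simp
  smul_mem' c f hf e := by
    have : taylor (C b) (c • f) = C (C c) * taylor (C b) f := by
      rw [Algebra.smul_def, taylor_mul]
      congr 1
      exact taylor_C _ _
    rw [this, coeff_C_mul]
    exact Dvd.dvd.mul_left (hf e) _

theorem dvd_coeff_taylor_of_mem_vanishing {a b x y : ℝ} {M : ℕ} {f : ℝ[X][X]}
    (hf : f ∈ vanishing a b M) (h : y = a * x + b) (e : ℕ) :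
    (X - C a) ^ (M - e) ∣ (taylor (C y - C x * X) f).coeff e := by
  have h1 : C y - C x * X = -C x * (X - C a) + C b := by
    rw [h, C_add, C_mul]; ring
  rw [h1, ← taylor_taylor, coeff_taylor_eq_sum]
  refine Finset.dvd_sum fun i _ => ?_
  by_cases hi : e ≤ i
  · have h2 : (X - C a) ^ (M - e) ∣ (X - C a) ^ (M - i) * (X - C a) ^ (i - e) := by
      rw [← pow_add]
      exact pow_dvd_pow _ (by omega)
    refine h2.trans (mul_dvd_mul (Dvd.dvd.mul_left (hf i) _) ?_)
    rw [mul_pow]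
    exact dvd_mul_left _ _
  · rw [Nat.choose_eq_zero_of_lt (by omega)]
    simp

theorem coeff_taylor_C_C_mem (S : Submodule ℝ ℝ[X][X]) {F : ℝ[X][X][X]} (hF : ∀ j, F.coeff j ∈ S)
    (x : ℝ) (j : ℕ) : (taylor (C (C x)) F).coeff j ∈ S := by
  rw [coeff_taylor_eq_sum]
  refine sum_mem fun i _ => ?_
  have : ((i.choose j : ℕ) : ℝ[X][X]) * F.coeff i * C (C x) ^ (i - j) =
      ((i.choose j : ℝ) * x ^ (i - j)) • F.coeff i := by
    rw [Algebra.smul_def]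
    have : algebraMap ℝ ℝ[X][X] ((i.choose j : ℝ) * x ^ (i - j)) =
      ((i.choose j : ℕ) : ℝ[X][X]) * C (C x) ^ (i - j) := by
      rw [map_mul, map_pow, map_natCast]
      rfl
    rw [this]; ring
  rw [this]
  exact S.smul_mem _ (hF i)

theorem dvd_pointCoeff {a b x y : ℝ} {M : ℕ} {F : ℝ[X][X][X]}
    (hF : ∀ j, F.coeff j ∈ vanishing a b M) (h : y = a * x + b) (e j : ℕ) :
    (X - C a) ^ (M - e) ∣ pointCoeff x y e j F := by
  rw [pointCoeff_apply, coeff_center]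
  exact dvd_coeff_taylor_of_mem_vanishing (coeff_taylor_C_C_mem _ hF x j) h e

/-- The subspace of polynomials in `x`, `v`, `u` vanishing to order at least `M` along `u = a`,
`v = b`. -/
def vanishingAlong (a b : ℝ) (M : ℕ) : Submodule ℝ ℝ[X][X][X] where
  carrier := {F | ∀ j, F.coeff j ∈ vanishing a b M}
  add_mem' hf hg j := by
    rw [coeff_add]
    exact add_mem (hf j) (hg j)
  zero_mem' e := by simp
  smul_mem' c f hf j := by
    rw [coeff_smul]
    exact Submodule.smul_mem _ c (hf j)

/-- A Taylor coefficient in `u` and `v` of the coefficient of `x ^ j`. -/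
def flagCoeff (a b : ℝ) (j e r : ℕ) : ℝ[X][X][X] →ₗ[ℝ] ℝ where
  toFun F := (taylor a ((taylor (C b) (F.coeff j)).coeff e)).coeff r
  map_add' F G := by simp
  map_smul' c F := by
    have : taylor (C b) ((c • F).coeff j) = C (C c) * taylor (C b) (F.coeff j) := by
      rw [coeff_smul, Algebra.smul_def, taylor_mul]
      congr 1
      exact taylor_C _ _
    rw [this, coeff_C_mul, taylor_mul, taylor_C, coeff_C_mul]
    rfl

theorem natDegree_le_of_mem_flagSpace {A B : ℕ} {F : ℝ[X][X][X]} (hF : F ∈ flagSpace A B) :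
    F.natDegree ≤ B := by
  induction hF using Submodule.span_induction with
  | zero => simp
  | add F G _ _ hF hG => exact natDegree_add_le_of_degree_le hF hG
  | smul c F _ hF => exact (natDegree_smul_le _ _).trans hF
  | mem F h =>
    obtain ⟨α, β, γ, δ, h, h', rfl⟩ := h
    refine le_trans ?_ h'
    have h1 : (C (C X) ^ α * C X ^ β : ℝ[X][X][X]).natDegree ≤ 0 := by
      have : (C (C X) ^ α * C X ^ β : ℝ[X][X][X]) = C (C X ^ α * X ^ β) := by
        rw [C_mul, C_pow, C_pow]
      rw [this, natDegree_C]
    have h2 : ((C X + C (C X) * X : ℝ[X][X][X]) ^ δ).natDegree ≤ δ * 1 :=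
      natDegree_pow_le_of_le δ (by compute_degree)
    have h3 : (X ^ γ : ℝ[X][X][X]).natDegree ≤ γ := natDegree_X_pow_le _
    exact (natDegree_mul_le_of_le (natDegree_mul_le_of_le h1 h3) h2).trans (by omega)

theorem finrank_le_inf_vanishingAlong {A B : ℕ} {W : Submodule ℝ ℝ[X][X][X]}
    (hW : W ≤ flagSpace A B) (a b : ℝ) (M : ℕ) :
    2 * finrank ℝ W ≤ 2 * finrank ℝ (W ⊓ vanishingAlong a b M : Submodule ℝ ℝ[X][X][X]) +
      (B + 1) * (M * (M + 1)) := by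
  have hfin : FiniteDimensional ℝ W := Submodule.finiteDimensional_of_le hW
  let s := (Finset.range (B + 1)) ×ˢ (Finset.range M).sigma fun e => Finset.range (M - e)
  have h1 := Submodule.finrank_le_inf_iInf_ker
    (fun k : ℕ × (Σ _ : ℕ, ℕ) => flagCoeff a b k.1 k.2.1 k.2.2) W s (fun _ => ⊤) (fun _ => 1)
    (fun _ _ _ _ => Submodule.mem_top) (fun _ _ => by simp)
  have hs : ∑ k ∈ s, 1 = (B + 1) * ∑ e ∈ Finset.range M, (M - e) := by
    simp [s]
  have hM : (∑ e ∈ Finset.range M, (M - e)) * 2 = M * (M + 1) := by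
    clear * -
    induction M with
    | zero => simp
    | succ M ih =>
      rw [Finset.sum_range_succ']
      simp only [Nat.add_sub_add_right]
      rw [add_mul, ih]
      simp
      ring
  have h2 : W ⊓ ⨅ k ∈ s, LinearMap.ker (flagCoeff a b k.1 k.2.1 k.2.2) ≤
      W ⊓ vanishingAlong a b M := by
    refine le_inf inf_le_left ?_
    rintro F ⟨hFW, hF⟩ j e
    simp only [SetLike.mem_coe, Submodule.mem_iInf, LinearMap.mem_ker] at hF
    by_cases hj : j ≤ B
    · rw [X_sub_C_pow_dvd_iff, ← taylor_apply, X_pow_dvd_iff]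
      intro r hr
      refine hF (j, ⟨e, r⟩) ?_
      simp only [s, Finset.mem_product, Finset.mem_sigma, Finset.mem_range]
      omega
    · rw [coeff_eq_zero_of_natDegree_lt
        ((natDegree_le_of_mem_flagSpace (hW hFW)).trans_lt (not_le.mp hj))]
      simp
  have hfin2 : FiniteDimensional ℝ (W ⊓ vanishingAlong a b M : Submodule ℝ ℝ[X][X][X]) :=
    Submodule.finiteDimensional_inf_left _ _
  have h3 := Submodule.finrank_mono h2
  rw [hs] at h1
  nlinarith

/-- Multiples of `Q` of degree at most `d`. -/
def dvdDegreeLE (Q : ℝ[X]) (d : ℕ) : Submodule ℝ ℝ[X] :=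
  (degreeLT ℝ (d + 1 - Q.natDegree)).map (LinearMap.mulLeft ℝ Q)

instance (n : ℕ) : FiniteDimensional ℝ (degreeLT ℝ n) :=
  Module.Finite.equiv (degreeLTEquiv ℝ n).symm

instance (Q : ℝ[X]) (d : ℕ) : FiniteDimensional ℝ (dvdDegreeLE Q d) :=
  Module.Finite.map _ _

theorem finrank_dvdDegreeLE_le (Q : ℝ[X]) (d : ℕ) :
    finrank ℝ (dvdDegreeLE Q d) ≤ d + 1 - Q.natDegree := by
  refine (Submodule.finrank_map_le _ _).trans ?_
  rw [(degreeLTEquiv ℝ _).finrank_eq, Module.finrank_fintype_fun_eq_card, Fintype.card_fin]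

theorem mem_dvdDegreeLE {Q f : ℝ[X]} {d : ℕ} (hf : f.natDegree ≤ d) (h : Q ∣ f) :
    f ∈ dvdDegreeLE Q d := by
  obtain ⟨g, rfl⟩ := h
  by_cases hg : g = 0
  · simp [hg]
  by_cases hQ : Q = 0
  · simp [hQ]
  refine ⟨g, ?_, rfl⟩
  rw [natDegree_mul hQ hg] at hf
  rw [SetLike.mem_coe, mem_degreeLT, degree_eq_natDegree hg, Nat.cast_lt]
  omega

/-- Imposing the vanishing of the point coefficients of weight at most `3 * B`, where `v` has
weight `n` and `x` has weight `3`. -/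
def pointConditions {ι : Type*} (x y : ι → ℝ) (n B m : ℕ) : Submodule ℝ ℝ[X][X][X] where
  carrier := {F | ∀ i e j, e < m → n * e + 3 * j ≤ 3 * B → pointCoeff (x i) (y i) e j F = 0}
  add_mem' hF hG i e j he hj := by
    rw [map_add, hF i e j he hj, hG i e j he hj, add_zero]
  zero_mem' i e j _ _ := map_zero _
  smul_mem' c F hF i e j he hj := by
    rw [map_smul, hF i e j he hj, smul_zero]

theorem finrank_le_inf_pointConditions {ι : Type*} [Fintype ι] (x y : ι → ℝ) {n A B : ℕ}
    (hn : 3 ≤ n) {W : Submodule ℝ ℝ[X][X][X]} (hW : W ≤ flagSpace A B) (D : ι → ℕ → ℝ[X])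
    (hD : ∀ F ∈ W, ∀ i e j, D i e ∣ pointCoeff (x i) (y i) e j F) (m : ℕ) (hm : m ≤ A + 1) :
    finrank ℝ W ≤ finrank ℝ (W ⊓ pointConditions x y n B m : Submodule ℝ ℝ[X][X][X]) +
      ∑ e ∈ Finset.range m, ∑ j ∈ (Finset.range (B + 1)).filter fun j => n * e + 3 * j ≤ 3 * B,
        ∑ i, (A - e + j + 1 - (D i e).natDegree) := by
  induction m with
  | zero =>
    have : W ⊓ pointConditions x y n B 0 = W :=
      inf_eq_left.mpr fun F _ i e j he _ => absurd he (Nat.not_lt_zero _)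
    rw [this]
    simp
  | succ m ih =>
    have ih := ih (by omega)
    have hfin : FiniteDimensional ℝ W := Submodule.finiteDimensional_of_le hW
    set V := W ⊓ pointConditions x y n B m with hV
    have hfinV : FiniteDimensional ℝ V := Submodule.finiteDimensional_inf_left _ _
    let s := ((Finset.range (B + 1)).filter fun j => n * m + 3 * j ≤ 3 * B) ×ˢ
      (Finset.univ : Finset ι)
    have h1 := Submodule.finrank_le_inf_iInf_ker
      (fun k : ℕ × ι => pointCoeff (x k.2) (y k.2) m k.1) V s
      (fun k => dvdDegreeLE (D k.2 m) (A - m + k.1))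
      (fun k => A - m + k.1 + 1 - (D k.2 m).natDegree)
      (by
        rintro ⟨j, i⟩ hk F ⟨hFW, hF⟩
        simp only [s, Finset.mem_product, Finset.mem_filter] at hk
        refine mem_dvdDegreeLE (natDegree_pointCoeff_le _ _ (hW hFW) (by omega)
          fun e' j' he' hj' => hF i e' j' he' ?_) (hD F hFW i m j)
        obtain ⟨d, rfl⟩ : ∃ d, m = e' + d := ⟨m - e', by omega⟩
        have h3 : 3 * d ≤ n * d := Nat.mul_le_mul_right d hn
        have h4 : n * (e' + d) = n * e' + n * d := mul_add _ _ _
        omega)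
      (fun k _ => finrank_dvdDegreeLE_le _ _)
    have h2 : V ⊓ ⨅ k ∈ s, LinearMap.ker (pointCoeff (x k.2) (y k.2) m k.1) ≤
        W ⊓ pointConditions x y n B (m + 1) := by
      rintro F ⟨⟨hFW, hF⟩, hF'⟩
      simp only [SetLike.mem_coe, Submodule.mem_iInf, LinearMap.mem_ker] at hF'
      refine ⟨hFW, fun i e j he hj => ?_⟩
      rcases Nat.lt_succ_iff_lt_or_eq.mp he with he | rfl
      · exact hF i e j he hj
      · refine hF' (j, i) ?_
        simp only [s, Finset.mem_product, Finset.mem_filter, Finset.mem_range, Finset.mem_univ]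
        exact ⟨⟨by omega, hj⟩, trivial⟩
    have hfin2 : FiniteDimensional ℝ
        (W ⊓ pointConditions x y n B (m + 1) : Submodule ℝ ℝ[X][X][X]) :=
      Submodule.finiteDimensional_inf_left _ _
    have h3 := Submodule.finrank_mono h2
    rw [Finset.sum_product] at h1
    dsimp only at h1
    rw [Finset.sum_range_succ]
    omega

theorem sum_sum_filter_mem {ι : Type*} [Fintype ι] (L : Finset (Finset ι)) (f : Finset ι → ℝ) :
    ∑ i, ∑ S ∈ L with i ∈ S, f S = ∑ S ∈ L, (S.card : ℝ) * f S := by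
  simp only [Finset.sum_filter]
  rw [Finset.sum_comm]
  refine Finset.sum_congr rfl fun S _ => ?_
  rw [← Finset.sum_filter, Finset.sum_const, nsmul_eq_mul]
  congr 2
  simp

/-- Each point is joined to the other ones by the blocks through it. -/
theorem sum_card_sub_one {ι : Type*} [Fintype ι] {L : Finset (Finset ι)}
    (hL : ∀ i j, i ≠ j → ∃! S, S ∈ L ∧ i ∈ S ∧ j ∈ S) (i : ι) :
    ∑ S ∈ L with i ∈ S, ((S.card : ℝ) - 1) = Fintype.card ι - 1 := by
  have h1 : (Finset.univ.erase i) = (L.filter (i ∈ ·)).biUnion (·.erase i) := by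
    ext j
    simp only [Finset.mem_erase, Finset.mem_univ, and_true, Finset.mem_biUnion, Finset.mem_filter]
    constructor
    · intro hj
      obtain ⟨S, ⟨hS, hi, hj'⟩, _⟩ := hL i j (Ne.symm hj)
      exact ⟨S, ⟨hS, hi⟩, hj, hj'⟩
    · rintro ⟨S, _, hj, _⟩
      exact hj
  have h2 := congrArg Finset.card h1
  rw [Finset.card_biUnion, Finset.card_erase_of_mem (Finset.mem_univ i), Finset.card_univ] at h2
  · have h3 : 1 ≤ Fintype.card ι := Fintype.card_pos_iff.mpr ⟨i⟩
    have h4 := congrArg (Nat.cast (R := ℝ)) h2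
    rw [Nat.cast_sub h3, Nat.cast_sum, Nat.cast_one] at h4
    rw [h4]
    refine Finset.sum_congr rfl fun S hS => ?_
    rw [Finset.mem_filter] at hS
    rw [Finset.card_erase_of_mem hS.2, Nat.cast_sub (Finset.card_pos.mpr ⟨i, hS.2⟩), Nat.cast_one]
  · intro S hS T hT hST
    rw [Finset.mem_coe, Finset.mem_filter] at hS hT
    rw [Function.onFun, Finset.disjoint_left]
    intro j hj hj'
    rw [Finset.mem_erase] at hj hj'
    exact hST ((hL i j hj.1.symm).unique ⟨hS.1, hS.2, hj.2⟩ ⟨hT.1, hT.2, hj'.2⟩)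

theorem finrank_le_inf_iInf_vanishingAlong {κ : Type*} {A B : ℕ} {W : Submodule ℝ ℝ[X][X][X]}
    (hW : W ≤ flagSpace A B) (u v : κ → ℝ) (M : κ → ℕ) (L : Finset κ) :
    2 * finrank ℝ W ≤
      2 * finrank ℝ (W ⊓ ⨅ S ∈ L, vanishingAlong (u S) (v S) (M S) : Submodule ℝ ℝ[X][X][X]) +
        (B + 1) * ∑ S ∈ L, M S * (M S + 1) := by
  induction L using Finset.induction_on with
  | empty =>
    have : ⨅ S ∈ (∅ : Finset κ), vanishingAlong (u S) (v S) (M S) = ⊤ := by simp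
    rw [this, inf_top_eq]
    omega
  | insert S L hS ih =>
    rw [Finset.sum_insert hS, Finset.iInf_insert, inf_comm (vanishingAlong (u S) (v S) (M S)),
      ← inf_assoc]
    have := finrank_le_inf_vanishingAlong (inf_le_left.trans hW :
      W ⊓ ⨅ S ∈ L, vanishingAlong (u S) (v S) (M S) ≤ _) (u S) (v S) (M S)
    rw [mul_add]
    omega

theorem exists_cubic_pos {p : ℝ} (hp : 0 < p) (q r s : ℝ) :
    ∃ N : ℕ, 0 < p * N ^ 3 + q * N ^ 2 + r * N + s := by
  obtain ⟨N, hN⟩ := exists_nat_gt ((|q| + |r| + |s|) / p + 1)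
  refine ⟨N, ?_⟩
  have h1 : (1 : ℝ) ≤ N := by
    have : 0 ≤ (|q| + |r| + |s|) / p := by positivity
    linarith
  have h2 : |q| + |r| + |s| < p * N := by
    rw [mul_comm, ← div_lt_iff₀ hp]
    linarith
  have hN2 : (1 : ℝ) ≤ N ^ 2 := one_le_pow₀ h1
  have h3 : (|q| + |r| + |s|) * N ^ 2 < p * N * N ^ 2 := mul_lt_mul_of_pos_right h2 (by positivity)
  have hq : -|q| * N ^ 2 ≤ q * N ^ 2 :=
    mul_le_mul_of_nonneg_right (neg_abs_le q) (by positivity)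
  have hr : -|r| * N ^ 2 ≤ r * N := by
    have : |r| * N ≤ |r| * N ^ 2 := mul_le_mul_of_nonneg_left (by nlinarith) (abs_nonneg r)
    have : -|r| * N ≤ r * N := mul_le_mul_of_nonneg_right (neg_abs_le r) (by positivity)
    linarith
  have hs : -|s| * N ^ 2 ≤ s := by
    have : |s| * 1 ≤ |s| * N ^ 2 := mul_le_mul_of_nonneg_left hN2 (abs_nonneg s)
    linarith [neg_abs_le s]
  nlinarith

theorem sum_range_quadratic (a b c : ℝ) (K : ℕ) :
    ∑ e ∈ Finset.range (K + 1), (a + b * e + c * (e : ℝ) ^ 2) =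
      a * (K + 1) + b * (K * (K + 1) / 2) + c * (K * (K + 1) * (2 * K + 1) / 6) := by
  induction K with
  | zero => simp
  | succ K ih =>
    rw [Finset.sum_range_succ, ih]
    push_cast
    ring

theorem sum_linear_le {J : Finset ℕ} {h a b : ℝ} (hJ : ∀ j ∈ J, (j : ℝ) ≤ h) (h0 : 0 ≤ h)
    (ha : 0 ≤ a) (hb : 0 ≤ b) :
    ∑ j ∈ J, (a + b * j) ≤ a * (h + 1) + b * (h * (h + 1) / 2) := by
  have h1 : J ⊆ Finset.range (⌊h⌋₊ + 1) := fun j hj =>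
    Finset.mem_range.mpr (Nat.lt_succ_of_le (Nat.le_floor (hJ j hj)))
  have h2 : (⌊h⌋₊ : ℝ) ≤ h := Nat.floor_le h0
  refine (Finset.sum_le_sum_of_subset_of_nonneg h1 fun j _ _ => by positivity).trans ?_
  have := sum_range_quadratic a b 0 ⌊h⌋₊
  simp only [zero_mul, add_zero] at this
  rw [this]
  gcongr

/-- The total number of point conditions. -/
theorem sum_pointConditions_le {ι : Type*} [Fintype ι] {n N : ℕ} (hn : Fintype.card ι = n)
    (hn1 : 1 ≤ n) {r : ι → ℝ} {R : ℝ} (hr1 : ∀ i, 1 ≤ r i) (hrn : ∀ i, r i ≤ n - 1)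
    (hrR : ∑ i, r i = R) (hRn : n ≤ R) (hR : R ≤ n ^ 2 + n) {d : ι → ℕ → ℕ}
    (hd : ∀ i, ∀ e ≤ 6 * N, (d i e : ℝ) = 3 * N * (n - 1 + r i) - r i * e) :
    ((∑ e ∈ Finset.range (6 * N + 1),
      ∑ j ∈ (Finset.range (2 * n * N + 1)).filter fun j => n * e + 3 * j ≤ 3 * (2 * n * N),
        ∑ i, (6 * n * N - e + j + 1 - d i e) : ℕ) : ℝ) ≤
      (8 * n ^ 3 * N ^ 2 + 6 * n ^ 2 * N + 6 * n ^ 2 * N ^ 2 + 3 * n * N - 6 * n * N ^ 2 * R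
          - 3 * N * R + n) * ((6 * N : ℕ) + 1) +
      (-5 / 3 * n ^ 3 * N - 3 * n ^ 2 * N + 3 * n * N * R - 1 / 2 * n ^ 2 + R - n) *
        ((6 * N : ℕ) * ((6 * N : ℕ) + 1) / 2) +
      (-1 / 3 * n * R + 1 / 3 * n ^ 2 + 1 / 18 * n ^ 3) *
        ((6 * N : ℕ) * ((6 * N : ℕ) + 1) * (2 * (6 * N : ℕ) + 1) / 6) := by
  have key : ((∑ e ∈ Finset.range (6 * N + 1),
      ∑ j ∈ (Finset.range (2 * n * N + 1)).filter fun j => n * e + 3 * j ≤ 3 * (2 * n * N),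
        ∑ i, (6 * n * N - e + j + 1 - d i e) : ℕ) : ℝ) ≤
      ∑ e ∈ Finset.range (6 * N + 1),
        ((3 * N * (n ^ 2 + n - R) + n + (R - n) * e) * (n * (6 * N - e) / 3 + 1) +
          n * (n * (6 * N - e) / 3 * (n * (6 * N - e) / 3 + 1) / 2)) := by
    rw [Nat.cast_sum]
    refine Finset.sum_le_sum fun e he => ?_
    have he := Nat.lt_succ_iff.mp (Finset.mem_range.mp he)
    have he' : (e : ℝ) ≤ 6 * N := by exact_mod_cast he
    have hcost : ∀ j : ℕ, ((∑ i, (6 * n * N - e + j + 1 - d i e) : ℕ) : ℝ) =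
        (3 * N * (n ^ 2 + n - R) + n + (R - n) * e) + n * j := by
      intro j
      have h : ∀ i, ((6 * n * N - e + j + 1 - d i e : ℕ) : ℝ) =
          (6 * n * N + 1 + j - e) - 3 * N * (n - 1) + r i * (e - 3 * N) := by
        intro i
        have hAe : e ≤ 6 * n * N := he.trans (by nlinarith)
        have hcast : ((6 * n * N - e + j + 1 : ℕ) : ℝ) = 6 * n * N + 1 + j - e := by
          push_cast [Nat.cast_sub hAe]
          ring
        rw [Nat.cast_sub, hcast, hd i e he]
        · ring
        · have h5 : 3 * (N : ℝ) * (n - 1 + r i) ≤ 3 * N * (2 * n) :=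
            mul_le_mul_of_nonneg_left (by linarith [hrn i]) (by positivity)
          have h6 : (e : ℝ) ≤ r i * e := le_mul_of_one_le_left (by positivity) (hr1 i)
          have h7 : (0 : ℝ) ≤ j := by positivity
          rw [← Nat.cast_le (α := ℝ), hd i e he, hcast]
          linarith
      rw [Nat.cast_sum, Finset.sum_congr rfl fun i _ => h i, Finset.sum_add_distrib,
        ← Finset.sum_mul, hrR, Finset.sum_const, Finset.card_univ, hn, nsmul_eq_mul]
      ring
    rw [Nat.cast_sum, Finset.sum_congr rfl fun j _ => hcost j]
    have hP : 0 ≤ 3 * N * (n ^ 2 + n - R) + n + (R - n) * e := by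
      have h3 : 0 ≤ n ^ 2 + n - R := by linarith
      have h4 : 0 ≤ R - n := by linarith
      positivity
    refine sum_linear_le (fun j hj => ?_) ?_ hP (by positivity)
    · have h3 := (Finset.mem_filter.mp hj).2
      have h4 : (n * e + 3 * j : ℝ) ≤ 3 * (2 * n * N) := by exact_mod_cast h3
      linarith
    · have : (0 : ℝ) ≤ 6 * N - e := by linarith
      positivity
  refine key.trans (le_of_eq ?_)
  rw [← sum_range_quadratic]
  exact Finset.sum_congr rfl fun e _ => by ring

theorem finrank_pos_of_count {n N f₀ f₁ f₂ f₃ s t : ℕ} {R : ℝ}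
    (hN : 0 < 2 * n * (n ^ 2 + 3 * n - 3 * R) * N ^ 3 +
      (-21 * n ^ 2 + 9 * n - 9 * R - 8 * n ^ 3) * N ^ 2 +
      (-4 * n - 3 * R - 29 / 3 * n ^ 2 + 2 / 3 * n * R - 1 / 9 * n ^ 3) * N + (-2 * n))
    (d₁ : (6 * n * N + 1) * (2 * n * N + 1) * (6 * n * N + 2 * n * N + 2) ≤ 2 * f₀)
    (d₂ : 2 * f₀ ≤ 2 * f₁ + (2 * n * N + 1) * ((4 * n * N + 1) * (4 * n * N + 1 + 1)))
    (d₃ : 2 * f₁ ≤ 2 * f₂ + (2 * n * N + 1) * s)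
    (d₄ : f₂ ≤ f₃ + t)
    (hs : (s : ℝ) = 9 * N ^ 2 * (n ^ 2 - n + R) + 3 * N * R)
    (ht : t ≤ (8 * n ^ 3 * N ^ 2 + 6 * n ^ 2 * N + 6 * n ^ 2 * N ^ 2 + 3 * n * N
          - 6 * n * N ^ 2 * R - 3 * N * R + n) * ((6 * N : ℕ) + 1) +
      (-5 / 3 * n ^ 3 * N - 3 * n ^ 2 * N + 3 * n * N * R - 1 / 2 * n ^ 2 + R - n) *
        ((6 * N : ℕ) * ((6 * N : ℕ) + 1) / 2) +
      (-1 / 3 * n * R + 1 / 3 * n ^ 2 + 1 / 18 * n ^ 3) *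
        ((6 * N : ℕ) * ((6 * N : ℕ) + 1) * (2 * (6 * N : ℕ) + 1) / 6)) :
    0 < f₃ := by
  rify at d₁ d₂ d₃ d₄ ⊢
  rw [hs] at d₃
  push_cast at ht
  linarith

/-- The dimension count producing an interpolating polynomial. -/
theorem exists_mem_flagSpace {ι : Type*} [Fintype ι] {x y : ι → ℝ}
    {L : Finset (Finset ι)} {u v : Finset ι → ℝ}
    (hline : ∀ S ∈ L, ∀ k, k ∈ S ↔ y k = u S * x k + v S) (h2 : ∀ S ∈ L, 2 ≤ S.card)
    (hL : ∀ i j, i ≠ j → ∃! S, S ∈ L ∧ i ∈ S ∧ j ∈ S) {n : ℕ} (hn : Fintype.card ι = n)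
    (hn3 : 3 ≤ n) (hR : 3 * ∑ S ∈ L, S.card < n ^ 2 + 3 * n) :
    ∃ N : ℕ, ∃ F ∈ flagSpace (6 * n * N) (2 * n * N), F ≠ 0 ∧
      (∀ j, F.coeff j ∈ vanishing 0 0 (4 * n * N + 1)) ∧
      ∀ i e j, n * e + 3 * j ≤ 3 * (2 * n * N) → pointCoeff (x i) (y i) e j F = 0 := by
  set R : ℝ := ∑ S ∈ L, (S.card : ℝ) with hRdef
  have hR' : 3 * R < n ^ 2 + 3 * n := by
    rw [hRdef]; exact_mod_cast hR
  have hn3' : (3 : ℝ) ≤ n := by exact_mod_cast hn3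
  let r : ι → ℝ := fun i => (L.filter (i ∈ ·)).card
  have hr1 : ∀ i, 1 ≤ r i := fun i => by
    obtain ⟨j, hj⟩ : ∃ j, j ≠ i := by
      have : 1 < Fintype.card ι := by omega
      have := Fintype.one_lt_card_iff_nontrivial.mp this
      exact exists_ne i
    obtain ⟨S, ⟨hS, hi, _⟩, _⟩ := hL i j hj.symm
    exact Nat.one_le_cast.mpr (Finset.card_pos.mpr ⟨S, Finset.mem_filter.mpr ⟨hS, hi⟩⟩)
  have hsum : ∀ i, ∑ S ∈ L with i ∈ S, (S.card : ℝ) = n - 1 + r i := fun i => by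
    have := sum_card_sub_one hL i
    rw [Finset.sum_sub_distrib, Finset.sum_const, nsmul_eq_mul, mul_one, hn] at this
    linarith
  have hrn : ∀ i, r i ≤ n - 1 := fun i => by
    rw [← hn, ← sum_card_sub_one hL i, ← mul_one (r i), ← nsmul_eq_mul, ← Finset.sum_const]
    refine Finset.sum_le_sum fun S hS => ?_
    have : (2 : ℝ) ≤ S.card := by exact_mod_cast h2 S (Finset.mem_filter.mp hS).1
    linarith
  have hrR : ∑ i, r i = R := by
    have := sum_sum_filter_mem L fun _ => 1
    simpa using this
  have hRn : (n : ℝ) ≤ R := by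
    rw [← hrR, ← hn, Fintype.card, ← nsmul_one]
    exact Finset.card_nsmul_le_sum _ _ _ fun i _ => hr1 i
  have hsq : ∑ S ∈ L, (S.card : ℝ) ^ 2 = n ^ 2 - n + R := by
    have := sum_sum_filter_mem L fun S => (S.card : ℝ)
    simp only [hsum, Finset.sum_add_distrib, hrR, Finset.sum_const, Finset.card_univ, hn,
      nsmul_eq_mul] at this
    simp only [sq, ← this]
    ring
  obtain ⟨N, hN⟩ := exists_cubic_pos (p := 2 * n * (n ^ 2 + 3 * n - 3 * R))
    (mul_pos (by linarith) (by linarith)) (-21 * n ^ 2 + 9 * n - 9 * R - 8 * n ^ 3)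
    (-4 * n - 3 * R - 29 / 3 * n ^ 2 + 2 / 3 * n * R - 1 / 9 * n ^ 3) (-2 * n)
  refine ⟨N, ?_⟩
  set A := 6 * n * N with hA
  set B := 2 * n * N with hB
  set W₁ := flagSpace A B ⊓ vanishingAlong 0 0 (4 * n * N + 1) with hW₁
  set W := W₁ ⊓ ⨅ S ∈ L, vanishingAlong (u S) (v S) (3 * S.card * N) with hW
  have hWle : W ≤ flagSpace A B := inf_le_left.trans inf_le_left
  let D : ι → ℕ → ℝ[X] := fun i e =>
    ∏ S ∈ L with i ∈ S, (X - C (u S)) ^ (3 * S.card * N - e)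
  have hD : ∀ F ∈ W, ∀ i e j, D i e ∣ pointCoeff (x i) (y i) e j F := by
    intro F hF i e j
    refine Finset.prod_dvd_of_coprime ?_ fun S hS => ?_
    · intro S hS T hT hST
      rw [Finset.mem_coe, Finset.mem_filter] at hS hT
      refine IsCoprime.pow (isCoprime_X_sub_C_of_isUnit_sub ?_)
      rw [isUnit_iff_ne_zero, sub_ne_zero]
      intro huv
      apply hST
      have h1 := (hline S hS.1 i).mp hS.2
      have h2 := (hline T hT.1 i).mp hT.2
      have hv : v S = v T := by rw [huv] at h1; linarith
      ext k
      rw [hline S hS.1, hline T hT.1, huv, hv]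
    · rw [Finset.mem_filter] at hS
      have hFS := hF.2
      simp only [SetLike.mem_coe, Submodule.mem_iInf] at hFS
      exact dvd_pointCoeff (hFS S hS.1) ((hline S hS.1 i).mp hS.2) e j
  have hDdeg : ∀ i e, (D i e).natDegree = ∑ S ∈ L with i ∈ S, (3 * S.card * N - e) := by
    intro i e
    rw [natDegree_prod_of_monic _ _ fun S _ => (monic_X_sub_C _).pow _]
    simp
  have d1 := finrank_flagSpace A B
  have d2 := finrank_le_inf_vanishingAlong le_rfl (A := A) (B := B) 0 0 (4 * n * N + 1)
  have d3 := finrank_le_inf_iInf_vanishingAlong (inf_le_left : W₁ ≤ flagSpace A B) u v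
    (fun S => 3 * S.card * N) L
  have d4 := finrank_le_inf_pointConditions x y hn3 hWle D hD (6 * N + 1)
    (by rw [hA]; nlinarith)
  set Z := W ⊓ pointConditions x y n B (6 * N + 1) with hZ
  have hM : ((∑ S ∈ L, 3 * S.card * N * (3 * S.card * N + 1) : ℕ) : ℝ) =
      9 * N ^ 2 * (n ^ 2 - n + R) + 3 * N * R := by
    rw [← hsq, hRdef, Finset.mul_sum, Finset.mul_sum, ← Finset.sum_add_distrib, Nat.cast_sum]
    refine Finset.sum_congr rfl fun S _ => ?_
    push_cast
    ring
  have ht := sum_pointConditions_le (N := N) hn (by omega) hr1 hrn hrR hRn (by nlinarith)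
    (d := fun i e => (D i e).natDegree) (by
      intro i e he
      rw [hDdeg, Nat.cast_sum, ← hsum i, Finset.mul_sum]
      have : r i * e = ∑ S ∈ L with i ∈ S, (e : ℝ) := by
        rw [Finset.sum_const, nsmul_eq_mul]
      rw [this, ← Finset.sum_sub_distrib]
      refine Finset.sum_congr rfl fun S hS => ?_
      have hS2 := h2 S (Finset.mem_filter.mp hS).1
      rw [Nat.cast_sub (he.trans (Nat.mul_le_mul_right N (by omega)))]
      push_cast
      ring)
  have hpos := finrank_pos_of_count hN d1 d2 d3 d4 hM ht
  obtain ⟨F, hF, hF0⟩ := Submodule.exists_mem_ne_zero_of_ne_bot (p := Z) (by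
    intro h
    rw [h, finrank_bot] at hpos
    exact lt_irrefl _ hpos)
  refine ⟨F, hWle hF.1, hF0, hF.1.1.2, fun i e j hej => hF.2 i e j ?_ hej⟩
  by_contra he
  have : n * (6 * N + 1) ≤ n * e := Nat.mul_le_mul_left n (by omega)
  nlinarith

theorem Polynomial.gaussNorm_le {R : Type*} [CommRing R] {v : AbsoluteValue R ℝ} {c b : ℝ}
    {p : R[X]} (h : ∀ i, v (p.coeff i) * c ^ i ≤ b) : p.gaussNorm v c ≤ b := by
  obtain ⟨i, hi⟩ := exists_eq_gaussNorm v c p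
  rw [hi]
  exact h i

/-- Restriction to the surface of lines through the point `(c, 0)`, with the abscissa measured from
this point. -/
def pencilRestriction (c : ℝ) (F : ℝ[X][X][X]) : ℝ[X][X] :=
  taylor (C c) (F.map (evalRingHom (-(C c * X))))

theorem taylor_pencilRestriction (c x y : ℝ) (F : ℝ[X][X][X]) :
    taylor (C (x - c)) (pencilRestriction c F) =
      (center x y F).map (evalRingHom (C (x - c) * X - C y)) := by
  have h1 : center x y F = (taylor (C (C x)) F).map
      (taylorAlgHom (C y - C x * X : ℝ[X])).toRingHom := rfl
  have h2 : ((evalRingHom (C (x - c) * X - C y)).comp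
      (taylorAlgHom (C y - C x * X : ℝ[X])).toRingHom) = evalRingHom (-(C c * X)) := by
    refine RingHom.ext fun f => ?_
    change (taylor _ f).eval _ = f.eval _
    rw [taylor_eval]
    congr 1
    rw [C_sub]
    ring
  rw [h1, Polynomial.map_map, h2, map_taylor, pencilRestriction, taylor_taylor, ← C_add,
    sub_add_cancel]
  simp

theorem dvd_coeff_taylor_pencilRestriction {c x y : ℝ} (hx : x ≠ c) {F : ℝ[X][X][X]} {j e₀ : ℕ}
    (h : ∀ e < e₀, pointCoeff x y e j F = 0) :
    (X - C (y / (x - c))) ^ e₀ ∣ (taylor (C (x - c)) (pencilRestriction c F)).coeff j := by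
  have h1 : (C (x - c) * X - C y : ℝ[X]) = C (x - c) * (X - C (y / (x - c))) := by
    rw [mul_sub, ← C_mul, mul_div_cancel₀ _ (sub_ne_zero.mpr hx)]
  rw [taylor_pencilRestriction c x y, coeff_map, coe_evalRingHom, eval_eq_sum, h1]
  refine Finset.dvd_sum fun e _ => ?_
  beta_reduce
  by_cases he : e < e₀
  · rw [← pointCoeff_apply, h e he, zero_mul]
    exact dvd_zero _
  · rw [mul_pow]
    exact Dvd.dvd.mul_left (Dvd.dvd.mul_left (pow_dvd_pow _ (not_lt.mp he)) _) _

theorem X_pow_dvd_coeff_pencilRestriction {c : ℝ} {M : ℕ} {F : ℝ[X][X][X]}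
    (hF : ∀ j, F.coeff j ∈ vanishing 0 0 M) (j : ℕ) :
    X ^ M ∣ (pencilRestriction c F).coeff j := by
  have h := dvd_pointCoeff hF (show (0 : ℝ) = 0 * c + 0 by simp) 0 j
  rw [pointCoeff_apply, coeff_zero_eq_eval_zero] at h
  have h2 := taylor_pencilRestriction c c 0 F
  rw [sub_self, C_0, taylor_zero, zero_mul, sub_self] at h2
  rw [h2, coeff_map, coe_evalRingHom]
  simpa using h

/-- Polynomials whose coefficient of `x ^ j` has degree at most `A + j`. -/
def slopeLE (A : ℕ) : Submodule ℝ ℝ[X][X] where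
  carrier := {G | ∀ j, (G.coeff j).natDegree ≤ A + j}
  add_mem' hP hQ k := by
    rw [coeff_add]
    exact natDegree_add_le_of_degree_le (hP k) (hQ k)
  zero_mem' k := by simp
  smul_mem' c P hP k := by
    rw [coeff_smul]
    exact (natDegree_smul_le _ _).trans (hP k)

theorem mul_mem_slopeLE {A A' : ℕ} {P Q : ℝ[X][X]} (hP : P ∈ slopeLE A) (hQ : Q ∈ slopeLE A') :
    P * Q ∈ slopeLE (A + A') := by
  intro j
  rw [coeff_mul]
  refine natDegree_sum_le_of_forall_le _ _ fun q hq => ?_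
  refine (natDegree_mul_le_of_le (hP _) (hQ _)).trans ?_
  rw [Finset.HasAntidiagonal.mem_antidiagonal] at hq
  omega

theorem pow_mem_slopeLE {A : ℕ} {P : ℝ[X][X]} (hP : P ∈ slopeLE A) (n : ℕ) :
    P ^ n ∈ slopeLE (n * A) := by
  induction n with
  | zero =>
    intro j
    rw [pow_zero, coeff_one]
    split_ifs <;> simp
  | succ n ih =>
    rw [pow_succ, Nat.succ_mul]
    exact mul_mem_slopeLE ih hP

theorem C_mem_slopeLE {A : ℕ} {f : ℝ[X]} (hf : f.natDegree ≤ A) : C f ∈ slopeLE A := by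
  intro j
  rw [coeff_C]
  split_ifs
  · omega
  · simp

theorem C_mul_X_mem_slopeLE {A : ℕ} {f : ℝ[X]} (hf : f.natDegree ≤ A + 1) :
    C f * X ∈ slopeLE A := by
  intro j
  rw [coeff_C_mul, coeff_X]
  split_ifs with h
  · rw [mul_one]; omega
  · simp

theorem pencilRestriction_mem_slopeLE (c : ℝ) {A B : ℕ} {F : ℝ[X][X][X]}
    (hF : F ∈ flagSpace A B) : pencilRestriction c F ∈ slopeLE A := by
  induction hF using Submodule.span_induction with
  | zero => simp [pencilRestriction]
  | add F G _ _ hF hG =>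
    rw [pencilRestriction, Polynomial.map_add, map_add]
    exact add_mem hF hG
  | smul r F _ hF =>
    have : pencilRestriction c (r • F) = r • pencilRestriction c F := by
      have h : (algebraMap ℝ ℝ[X][X][X] r) = C (C (C r)) := rfl
      have h' : (algebraMap ℝ ℝ[X][X] r) = C (C r) := rfl
      rw [Algebra.smul_def, Algebra.smul_def, h, h', pencilRestriction, Polynomial.map_mul, map_C,
        taylor_mul, taylor_C, coe_evalRingHom, eval_C]
      rfl
    rw [this]
    exact Submodule.smul_mem _ r hF
  | mem F h =>
    obtain ⟨α, β, γ, δ, h, h', rfl⟩ := h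
    have e : pencilRestriction c (flagMonomial α β γ δ) =
        C X ^ α * C (-(C c * X)) ^ β * (C 1 * X + C (C c)) ^ γ * (C X * X) ^ δ := by
      have e1 : (flagMonomial α β γ δ).map (evalRingHom (-(C c * X))) =
          C X ^ α * C (-(C c * X)) ^ β * X ^ γ * (C (-(C c * X)) + C X * X) ^ δ := by
        simp only [flagMonomial, Polynomial.map_mul, Polynomial.map_pow, Polynomial.map_add, map_C,
          Polynomial.map_X, coe_evalRingHom, eval_C, eval_X]
      rw [pencilRestriction, e1]
      simp only [taylor_mul, taylor_pow, map_add, taylor_C, taylor_X]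
      rw [C_1, one_mul]
      congr 2
      rw [C_neg, C_mul]
      ring
    rw [e]
    have m := mul_mem_slopeLE (mul_mem_slopeLE (mul_mem_slopeLE
      (pow_mem_slopeLE (C_mem_slopeLE (A := 1) (f := X) natDegree_X_le) α)
      (pow_mem_slopeLE (C_mem_slopeLE (A := 1) (f := -(C c * X)) (by
        rw [natDegree_neg]; exact natDegree_C_mul_le c X |>.trans natDegree_X_le)) β))
      (pow_mem_slopeLE (A := 0) (add_mem (C_mul_X_mem_slopeLE (f := 1) (by simp))
        (C_mem_slopeLE (f := C c) (by simp))) γ))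
      (pow_mem_slopeLE (C_mul_X_mem_slopeLE (A := 0) (f := X) natDegree_X_le) δ)
    intro j
    refine (m j).trans ?_
    omega

theorem natDegree_pencilRestriction_le (c : ℝ) (F : ℝ[X][X][X]) :
    (pencilRestriction c F).natDegree ≤ F.natDegree := by
  rw [pencilRestriction, natDegree_taylor]
  exact natDegree_map_le

theorem finite_setOf_pencilRestriction_eq_zero {F : ℝ[X][X][X]} (hF : F ≠ 0) :
    {c : ℝ | pencilRestriction c F = 0}.Finite := by
  obtain ⟨j, hj⟩ : ∃ j, F.coeff j ≠ 0 := by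
    by_contra! h
    exact hF (Polynomial.ext (by simpa using h))
  have hinj : Function.Injective fun c : ℝ => (-(C c * X) : ℝ[X]) := by
    intro c d h
    have := congrArg (fun p : ℝ[X] => p.coeff 1) h
    simpa using this
  refine ((F.coeff j).roots.toFinset.finite_toSet.preimage hinj.injOn).subset fun c hc => ?_
  rw [Set.mem_ofPred_eq, pencilRestriction, taylor_eq_zero] at hc
  have := congrArg (fun p => p.coeff j) hc
  rw [Set.mem_preimage, Finset.mem_coe, Multiset.mem_toFinset, mem_roots hj, IsRoot.def]
  simpa [coeff_map] using this

theorem finite_setOf_div_sub_eq {x y x' y' : ℝ} (hy : y ≠ 0) (hx : x ≠ x') :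
    {c : ℝ | x ≠ c ∧ x' ≠ c ∧ y / (x - c) = y' / (x' - c)}.Finite := by
  refine (Set.finite_singleton ((y * x' - y' * x) / (y - y'))).subset ?_
  rintro c ⟨h1, h2, h3⟩
  rw [div_eq_div_iff (sub_ne_zero.mpr h1) (sub_ne_zero.mpr h2)] at h3
  have h4 : y - y' ≠ 0 := by
    intro h
    obtain rfl : y = y' := by linarith
    have := mul_left_cancel₀ hy h3
    exact hx (by linarith)
  rw [Set.mem_singleton_iff, eq_div_iff h4]
  linarith

theorem exists_pow_eq_eighth {n : ℕ} (hn : n ≠ 0) : ∃ c : ℝ, 0 < c ∧ c ≤ 1 ∧ c ^ n = 1 / 8 := by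
  refine ⟨(1 / 8 : ℝ) ^ ((n : ℝ)⁻¹), by positivity, ?_, Real.rpow_inv_natCast_pow (by norm_num) hn⟩
  exact Real.rpow_le_one (by norm_num) (by norm_num) (by positivity)

theorem gaussNorm_taylor_pencilRestriction_le {d c x y : ℝ} {n B : ℕ} (hd0 : 0 < d)
    (hn : n ≠ 0) (hd : d ^ n = 1 / 8) (hx : x ≠ c) {F : ℝ[X][X][X]}
    (h : ∀ e j, n * e + 3 * j ≤ 3 * B → pointCoeff x y e j F = 0) :
    (taylor (C (x - c)) (pencilRestriction c F)).gaussNorm (rootAbs (y / (x - c))) d ≤ d ^ B := by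
  refine gaussNorm_le fun j => ?_
  obtain ⟨e₀, h1, h2⟩ : ∃ e₀, 3 * B ≤ n * e₀ + 3 * j ∧ ∀ e < e₀, n * e + 3 * j ≤ 3 * B := by
    by_cases hj : j ≤ B
    · refine ⟨(3 * (B - j)) / n + 1, ?_, fun e he => ?_⟩
      · have := Nat.lt_mul_div_succ (3 * (B - j)) (Nat.pos_of_ne_zero hn)
        omega
      · have := (Nat.le_div_iff_mul_le (Nat.pos_of_ne_zero hn)).mp (Nat.lt_succ_iff.mp he)
        rw [mul_comm] at this
        omega
    · exact ⟨0, by omega, fun e he => absurd he (Nat.not_lt_zero e)⟩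
  have h3 := rootAbs_le_of_dvd
    (dvd_coeff_taylor_pencilRestriction hx fun e he => h e j (h2 e he))
  refine (mul_le_mul_of_nonneg_right h3 (by positivity)).trans ?_
  rw [← pow_le_pow_iff_left₀ (by positivity) (by positivity) hn]
  have e1 : ∀ k : ℕ, (d ^ k) ^ n = 2⁻¹ ^ (3 * k) := fun k => by
    rw [← pow_mul, mul_comm, pow_mul, hd, pow_mul]; norm_num
  rw [mul_pow, e1, e1, ← pow_mul, ← pow_add]
  exact pow_le_pow_of_le_one (by norm_num) (by norm_num) (by linarith)

/-- The incidence inequality for a configuration in which no line contains more than two thirds of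
the points. -/
theorem sq_add_le_sum_card {ι : Type*} [Fintype ι] {x y : ι → ℝ} (hx : x.Injective)
    (hy : ∀ i, y i ≠ 0) {L : Finset (Finset ι)} {u v : Finset ι → ℝ}
    (hline : ∀ S ∈ L, ∀ k, k ∈ S ↔ y k = u S * x k + v S) (h2 : ∀ S ∈ L, 2 ≤ S.card)
    (hL : ∀ i j, i ≠ j → ∃! S, S ∈ L ∧ i ∈ S ∧ j ∈ S) {n : ℕ} (hn : Fintype.card ι = n)
    (hn3 : 3 ≤ n)
    (hcol : ∀ α β γ : ℝ, (β ≠ 0 ∨ γ ≠ 0) →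
      3 * (Finset.univ.filter fun i => α + β * x i + γ * y i = 0).card ≤ 2 * n) :
    n ^ 2 + 3 * n ≤ 3 * ∑ S ∈ L, S.card := by
  by_contra! hR
  obtain ⟨N, F, hF, hF0, hq, hp⟩ := exists_mem_flagSpace hline h2 hL hn hn3 hR
  obtain ⟨c, hc⟩ : ∃ c, c ∉ {c : ℝ | pencilRestriction c F = 0} ∪ Set.range x ∪
      ⋃ p : {p : ι × ι // p.1 ≠ p.2}, {c : ℝ | x p.1.1 ≠ c ∧ x p.1.2 ≠ c ∧
        y p.1.1 / (x p.1.1 - c) = y p.1.2 / (x p.1.2 - c)} :=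
    (((finite_setOf_pencilRestriction_eq_zero hF0).union (Set.finite_range x)).union
      (Set.finite_iUnion fun p => finite_setOf_div_sub_eq (hy _)
        (hx.ne p.2))).exists_notMem
  simp only [Set.mem_union, Set.mem_iUnion, not_or, not_exists] at hc
  obtain ⟨⟨hG, hxc⟩, hU⟩ := hc
  have hxc : ∀ i, x i ≠ c := fun i h => hxc ⟨i, h⟩
  have hxc' : ∀ i, x i - c ≠ 0 := fun i => sub_ne_zero.mpr (hxc i)
  obtain ⟨d, hd0, hd1, hdn⟩ := exists_pow_eq_eighth (n := n) (by omega)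
  set A := 6 * n * N with hA
  set B := 2 * n * N with hB
  set G := pencilRestriction c F with hGdef
  have key := one_le_weightedSize (x := fun i => x i - c) (U := fun i => y i / (x i - c)) (c := d)
    hd0 hd1 (by rw [hn, hdn]) (by
      intro i j hij
      by_contra h
      exact hU ⟨(i, j), h⟩ ⟨hxc i, hxc j, hij⟩)
    (fun i => div_ne_zero (hy i) (hxc' i)) hxc' (by
      intro α β γ h
      rw [hn]
      convert hcol (α - β * c) β γ h using 5 with i
      rw [div_mul_cancel₀ _ (hxc' i)]
      ring) hG
  have b1 : ∏ i, (taylor (C (x i - c)) G).gaussNorm (rootAbs (y i / (x i - c))) d ≤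
      (1 / 8) ^ B := by
    have : (1 / 8 : ℝ) ^ B = ∏ _i : ι, d ^ B := by
      rw [Finset.prod_const, Finset.card_univ, hn, ← hdn, ← pow_mul, ← pow_mul, mul_comm]
    rw [this]
    exact Finset.prod_le_prod (fun i _ => gaussNorm_nonneg _ _ hd0.le) fun i _ =>
      gaussNorm_taylor_pencilRestriction_le hd0 (by omega) hdn (hxc i) (hp i)
  have b2 : G.gaussNorm (rootAbs 0) 1 ≤ 2⁻¹ ^ (4 * n * N + 1) := by
    refine gaussNorm_le fun j => ?_
    rw [one_pow, mul_one]
    refine rootAbs_le_of_dvd ?_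
    rw [C_0, sub_zero]
    exact X_pow_dvd_coeff_pencilRestriction hq j
  have b3 : G.gaussNorm degAbs 2⁻¹ ≤ 2 ^ A := by
    refine gaussNorm_le fun j => ?_
    have := degAbs_le (pencilRestriction_mem_slopeLE c hF j)
    calc degAbs (G.coeff j) * 2⁻¹ ^ j ≤ 2 ^ (A + j) * 2⁻¹ ^ j :=
          mul_le_mul_of_nonneg_right this (by positivity)
      _ = 2 ^ A := by rw [pow_add, mul_assoc, ← mul_pow]; norm_num
  have b4 : (4 : ℝ) ^ G.natDegree ≤ 4 ^ B :=
    pow_le_pow_right₀ (by norm_num)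
      ((natDegree_pencilRestriction_le c F).trans (natDegree_le_of_mem_flagSpace hF))
  have n2 : 0 ≤ G.gaussNorm (rootAbs 0) 1 := gaussNorm_nonneg _ _ zero_le_one
  have n3 : 0 ≤ G.gaussNorm degAbs 2⁻¹ := gaussNorm_nonneg _ _ (by norm_num)
  have b5 := mul_le_mul (mul_le_mul (mul_le_mul b1 b2 n2 (by positivity)) b3 n3 (by positivity))
    b4 (by positivity) (by positivity)
  have e8 : (1 / 8 : ℝ) ^ B = 2⁻¹ ^ (6 * n * N) := by
    rw [show 6 * n * N = 3 * B by rw [hB]; ring, pow_mul _ 3]; norm_num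
  have e4 : (4 : ℝ) ^ B = 2 ^ (4 * n * N) := by
    rw [show 4 * n * N = 2 * B by rw [hB]; ring, pow_mul _ 2]; norm_num
  have e1 : ∀ k : ℕ, (2⁻¹ : ℝ) ^ k * 2 ^ k = 1 := fun k => by rw [← mul_pow]; norm_num
  rw [e8, e4, pow_succ] at b5
  have e : (2⁻¹ : ℝ) ^ (6 * n * N) * (2⁻¹ ^ (4 * n * N) * 2⁻¹) * 2 ^ A * 2 ^ (4 * n * N) = 2⁻¹ := by
    calc _ = (2⁻¹ : ℝ) ^ (6 * n * N) * 2 ^ A * (2⁻¹ ^ (4 * n * N) * 2 ^ (4 * n * N)) * 2⁻¹ := by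
          ring
      _ = _ := by rw [e1, e1]; norm_num
  have := key.trans (b5.trans e.le)
  norm_num at this

/-- The weight of a line with `m` points in Hirzebruch's inequality. -/
def lineWeight (m : ℕ) : ℝ :=
  if m = 2 then 1 else if m = 3 then 3 / 4 else if m = 4 then 0 else 9 - 2 * m

theorem sub_sq_div_four_le_lineWeight {m : ℕ} (hm : 2 ≤ m) :
    (m : ℝ) - m ^ 2 / 4 ≤ lineWeight m := by
  unfold lineWeight
  split_ifs with h2 h3 h4
  · subst h2; norm_num
  · subst h3; norm_num
  · subst h4; norm_num
  · nlinarith [sq_nonneg ((m : ℝ) - 6)]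

theorem mul_sub_le_lineWeight {a s : ℕ} (ha : a ≤ 1) (h : 2 ≤ a + s) :
    (s * a : ℝ) - 5 / 8 * (s * (s - 1)) ≤ lineWeight (a + s) := by
  unfold lineWeight
  interval_cases a
  · split_ifs with h2 h3 h4
    · obtain rfl : s = 2 := by omega
      norm_num
    · obtain rfl : s = 3 := by omega
      norm_num
    · obtain rfl : s = 4 := by omega
      norm_num
    · have : (5 : ℝ) ≤ s := by exact_mod_cast (by omega : 5 ≤ s)
      push_cast
      nlinarith
  · split_ifs with h2 h3 h4
    · obtain rfl : s = 1 := by omega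
      norm_num
    · obtain rfl : s = 2 := by omega
      norm_num
    · obtain rfl : s = 3 := by omega
      norm_num
    · have : (4 : ℝ) ≤ s := by exact_mod_cast (by omega : 4 ≤ s)
      push_cast
      nlinarith

theorem sum_card_inter_of_notMem {ι : Type*} [Fintype ι] {L : Finset (Finset ι)}
    (hL : ∀ i j, i ≠ j → ∃! S, S ∈ L ∧ i ∈ S ∧ j ∈ S) {T : Finset ι} {i : ι} (hi : i ∉ T) :
    ∑ S ∈ L with i ∈ S, (S ∩ T).card = T.card := by
  have h (S : Finset ι) : (S ∩ T).card = ∑ j ∈ T, if j ∈ S then 1 else 0 := by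
    rw [Finset.inter_comm, ← Finset.filter_mem_eq_inter, Finset.card_filter]
  simp only [h]
  rw [Finset.sum_comm, Finset.card_eq_sum_ones]
  refine Finset.sum_congr rfl fun j hj => ?_
  obtain ⟨S, hS, hu⟩ := hL i j (fun e => hi (e ▸ hj))
  rw [← Finset.card_filter, Finset.card_eq_one]
  refine ⟨S, ?_⟩
  ext S'
  simp only [Finset.mem_filter, Finset.mem_singleton]
  refine ⟨fun h => hu _ ⟨h.1.1, h.1.2, h.2⟩, ?_⟩
  rintro rfl
  exact ⟨⟨hS.1, hS.2.1⟩, hS.2.2⟩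

theorem sum_compl_sum_filter_mem {ι : Type*} [Fintype ι] (L : Finset (Finset ι)) (T : Finset ι)
    (f : Finset ι → ℝ) :
    ∑ i ∈ Tᶜ, ∑ S ∈ L with i ∈ S, f S = ∑ S ∈ L, ((S \ T).card : ℝ) * f S := by
  simp only [Finset.sum_filter]
  rw [Finset.sum_comm]
  refine Finset.sum_congr rfl fun S _ => ?_
  rw [← Finset.sum_filter, Finset.sum_const, nsmul_eq_mul]
  congr 3
  ext i
  simp [and_comm]

theorem card_le_sum_lineWeight {ι : Type*} [Fintype ι] {L : Finset (Finset ι)} {n : ℕ}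
    (hn : Fintype.card ι = n) (h2 : ∀ S ∈ L, 2 ≤ S.card)
    (hL : ∀ i j, i ≠ j → ∃! S, S ∈ L ∧ i ∈ S ∧ j ∈ S) (hmax : ∀ S ∈ L, S.card + 3 ≤ n)
    (hR : (∀ S ∈ L, 3 * S.card ≤ 2 * n) → n ^ 2 + 3 * n ≤ 3 * ∑ S ∈ L, S.card) :
    (n : ℝ) ≤ ∑ S ∈ L, lineWeight S.card := by
  by_cases hc : ∀ S ∈ L, 3 * S.card ≤ 2 * n
  · have hR' : (n : ℝ) ^ 2 + 3 * n ≤ 3 * ∑ S ∈ L, (S.card : ℝ) := by exact_mod_cast hR hc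
    have hpairs : ∑ S ∈ L, (S.card : ℝ) * (S.card - 1) = n * (n - 1) := by
      rw [← sum_sum_filter_mem, Finset.sum_congr rfl fun i _ => sum_card_sub_one hL i,
        Finset.sum_const, Finset.card_univ, hn, nsmul_eq_mul]
    have hw : ∑ S ∈ L, (3 / 4 * (S.card : ℝ) - 1 / 4 * (S.card * (S.card - 1))) ≤
        ∑ S ∈ L, lineWeight S.card := by
      refine Finset.sum_le_sum fun S hS => ?_
      have := sub_sq_div_four_le_lineWeight (h2 S hS)
      linarith
    rw [Finset.sum_sub_distrib, ← Finset.mul_sum, ← Finset.mul_sum, hpairs] at hw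
    linarith
  · push Not at hc
    obtain ⟨T, hT, hTn⟩ := hc
    have hTmax := hmax T hT
    obtain ⟨k, hk⟩ := Nat.exists_eq_add_of_le (show T.card ≤ n by omega)
    have hkc : Tᶜ.card = k := by rw [Finset.card_compl, hn]; omega
    have hS1 : ∀ S ∈ L, S ≠ T → (S ∩ T).card ≤ 1 := by
      intro S hS hne
      by_contra! h
      obtain ⟨i, hi, j, hj, hij⟩ := Finset.one_lt_card.mp h
      rw [Finset.mem_inter] at hi hj
      exact hne ((hL i j hij).unique ⟨hS, hi.1, hj.1⟩ ⟨hT, hi.2, hj.2⟩)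
    have hsc (S : Finset ι) : (S ∩ T).card + (S \ T).card = S.card :=
      Finset.card_inter_add_card_sdiff S T
    have hcross : ∑ S ∈ L, ((S \ T).card : ℝ) * (S ∩ T).card = k * T.card := by
      rw [← sum_compl_sum_filter_mem]
      norm_cast
      rw [Finset.sum_congr rfl fun i hi =>
        sum_card_inter_of_notMem hL (Finset.mem_compl.mp hi), Finset.sum_const, hkc, smul_eq_mul]
    have hall : ∑ S ∈ L, ((S \ T).card : ℝ) * (S.card - 1) = k * (n - 1) := by
      rw [← sum_compl_sum_filter_mem, Finset.sum_congr rfl fun i _ => sum_card_sub_one hL i,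
        Finset.sum_const, hkc, hn, nsmul_eq_mul]
    have hout : ∑ S ∈ L, ((S \ T).card : ℝ) * ((S \ T).card - 1) = k * (k - 1) := by
      have : ∀ S ∈ L, ((S \ T).card : ℝ) * ((S \ T).card - 1) =
          (S \ T).card * (S.card - 1) - (S \ T).card * (S ∩ T).card := by
        intro S _
        rw [← hsc S]
        push_cast
        ring
      rw [Finset.sum_congr rfl this, Finset.sum_sub_distrib, hcross, hall, hk]
      push_cast
      ring
    have hw : ∑ S ∈ L.erase T,
        (((S \ T).card : ℝ) * (S ∩ T).card - 5 / 8 * ((S \ T).card * ((S \ T).card - 1))) ≤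
        ∑ S ∈ L.erase T, lineWeight S.card := by
      refine Finset.sum_le_sum fun S hS => ?_
      obtain ⟨hne, hS⟩ := Finset.mem_erase.mp hS
      have := mul_sub_le_lineWeight (hS1 S hS hne) ((h2 S hS).trans_eq (hsc S).symm)
      rwa [hsc] at this
    rw [Finset.sum_erase L (by simp), Finset.sum_sub_distrib, ← Finset.mul_sum, hcross, hout] at hw
    have hTw : lineWeight T.card = 9 - 2 * T.card := by
      unfold lineWeight
      rw [if_neg (by omega), if_neg (by omega), if_neg (by omega)]
    rw [← Finset.add_sum_erase L _ hT, hTw, hk]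
    have h3 : (3 : ℝ) ≤ k := by exact_mod_cast (by omega : 3 ≤ k)
    have hr : (2 * k + 1 : ℝ) ≤ T.card := by exact_mod_cast (by omega : 2 * k + 1 ≤ T.card)
    push_cast
    nlinarith [mul_nonneg (sub_nonneg.mpr h3) (sub_nonneg.mpr hr), sq_nonneg ((k : ℝ) - 3)]

theorem mem_affineSpan_pair_iff {p q : ℝ × ℝ} (h : p ≠ q) (z : ℝ × ℝ) :
    z ∈ affineSpan ℝ ({p, q} : Set (ℝ × ℝ)) ↔
      (q.1 - p.1) * (z.2 - p.2) = (q.2 - p.2) * (z.1 - p.1) := by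
  rw [mem_affineSpan_pair_iff_exists_lineMap_eq]
  simp only [AffineMap.lineMap_apply, Prod.ext_iff, vsub_eq_sub, vadd_eq_add, Prod.fst_add,
    Prod.snd_add, Prod.smul_fst, Prod.smul_snd, Prod.fst_sub, Prod.snd_sub, smul_eq_mul]
  constructor
  · rintro ⟨r, h1, h2⟩
    rw [← h1, ← h2]
    ring
  · intro hz
    by_cases h1 : q.1 - p.1 = 0
    · have h2 : q.2 - p.2 ≠ 0 := fun h2 =>
        h (Prod.ext (by linarith) (by linarith))
      refine ⟨(z.2 - p.2) / (q.2 - p.2), ?_, by field_simp; ring⟩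
      rw [h1, zero_mul, zero_eq_mul, or_iff_right h2] at hz
      rw [h1]
      linarith
    · refine ⟨(z.1 - p.1) / (q.1 - p.1), by field_simp; ring, ?_⟩
      field_simp
      linarith

theorem mem_affineSpan_pair_iff_of_eq_zero {a b c : ℝ} (hbc : b ≠ 0 ∨ c ≠ 0) {p q : ℝ × ℝ}
    (h : p ≠ q) (hp : a + b * p.1 + c * p.2 = 0) (hq : a + b * q.1 + c * q.2 = 0) (z : ℝ × ℝ) :
    z ∈ affineSpan ℝ ({p, q} : Set (ℝ × ℝ)) ↔ a + b * z.1 + c * z.2 = 0 := by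
  rw [mem_affineSpan_pair_iff h]
  constructor
  · intro hz
    by_cases h1 : q.1 - p.1 = 0
    · have h2 : q.2 - p.2 ≠ 0 := fun h2 =>
        h (Prod.ext (by linarith) (by linarith))
      refine (mul_eq_zero.mp ?_).resolve_left h2
      linear_combination (q.2 - z.2) * hp + (z.2 - p.2) * hq - b * hz
    · refine (mul_eq_zero.mp ?_).resolve_left h1
      linear_combination (q.1 - z.1) * hp + (z.1 - p.1) * hq + c * hz
  · intro hz
    obtain hb | hc := hbc
    · refine mul_left_cancel₀ hb ?_
      linear_combination (z.2 - p.2) * (hq - hp) - (q.2 - p.2) * (hz - hp)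
    · refine mul_left_cancel₀ hc ?_
      linear_combination (q.1 - p.1) * (hz - hp) - (z.1 - p.1) * (hq - hp)

theorem IsLine.exists_equation {L : Set (ℝ × ℝ)} (hL : IsLine L) :
    ∃ a b c : ℝ, (b ≠ 0 ∨ c ≠ 0) ∧ ∀ z, z ∈ L ↔ a + b * z.1 + c * z.2 = 0 := by
  obtain ⟨p, q, hpq, rfl⟩ := hL
  refine ⟨(q.2 - p.2) * p.1 - (q.1 - p.1) * p.2, -(q.2 - p.2), q.1 - p.1, ?_, fun z => ?_⟩
  · by_contra! h
    exact hpq (Prod.ext (by linarith) (by linarith))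
  · rw [SetLike.mem_coe, mem_affineSpan_pair_iff hpq]
    constructor <;> intro h <;> linear_combination h

theorem IsLine.eq_affineSpan {L : Set (ℝ × ℝ)} (hL : IsLine L) {p q : ℝ × ℝ} (h : p ≠ q)
    (hp : p ∈ L) (hq : q ∈ L) : L = affineSpan ℝ ({p, q} : Set (ℝ × ℝ)) := by
  obtain ⟨a, b, c, hbc, hz⟩ := hL.exists_equation
  ext z
  rw [SetLike.mem_coe,
    mem_affineSpan_pair_iff_of_eq_zero hbc h ((hz _).mp hp) ((hz _).mp hq), hz]

/-- The points of `P` on `L`, as a finset of the subtype `P`. -/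
def traceOn (P : Finset (ℝ × ℝ)) (L : Set (ℝ × ℝ)) : Finset P :=
  Finset.univ.filter fun i => (i : ℝ × ℝ) ∈ L

theorem mem_traceOn {P : Finset (ℝ × ℝ)} {L : Set (ℝ × ℝ)} {i : P} :
    i ∈ traceOn P L ↔ (i : ℝ × ℝ) ∈ L := by
  simp [traceOn]

theorem card_traceOn (P : Finset (ℝ × ℝ)) (L : Set (ℝ × ℝ)) :
    (traceOn P L).card = (ptsOn P L).card := by
  rw [← Finset.card_map (Function.Embedding.subtype (· ∈ P))]
  congr 1
  ext z
  simp [traceOn, ptsOn, and_comm]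

/-- The traces on `P` of the lines determined by `P`. -/
def lineTraces (P : Finset (ℝ × ℝ)) : Finset (Finset P) :=
  Finset.univ.filter fun S => 2 ≤ S.card ∧ ∃ L, IsLine L ∧ traceOn P L = S

theorem mem_lineTraces {P : Finset (ℝ × ℝ)} {S : Finset P} :
    S ∈ lineTraces P ↔ 2 ≤ S.card ∧ ∃ L, IsLine L ∧ traceOn P L = S := by
  simp [lineTraces]

theorem traceOn_injOn (P : Finset (ℝ × ℝ)) {L L' : Set (ℝ × ℝ)} (hL : IsLine L)
    (hL' : IsLine L') {i j : P} (hij : i ≠ j) (hi : i ∈ traceOn P L) (hj : j ∈ traceOn P L)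
    (hi' : i ∈ traceOn P L') (hj' : j ∈ traceOn P L') : L = L' := by
  have h : (i : ℝ × ℝ) ≠ j := fun e => hij (Subtype.ext e)
  rw [mem_traceOn] at *
  rw [hL.eq_affineSpan h hi hj, hL'.eq_affineSpan h hi' hj']

theorem isLine_affineSpan {p q : ℝ × ℝ} (h : p ≠ q) :
    IsLine (affineSpan ℝ ({p, q} : Set (ℝ × ℝ)) : Set (ℝ × ℝ)) :=
  ⟨p, q, h, rfl⟩

theorem existsUnique_mem_lineTraces {P : Finset (ℝ × ℝ)} (i j : P) (hij : i ≠ j) :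
    ∃! S, S ∈ lineTraces P ∧ i ∈ S ∧ j ∈ S := by
  have h : (i : ℝ × ℝ) ≠ j := fun e => hij (Subtype.ext e)
  have hi : i ∈ traceOn P (affineSpan ℝ ({↑i, ↑j} : Set (ℝ × ℝ))) :=
    mem_traceOn.mpr (left_mem_affineSpan_pair _ _ _)
  have hj : j ∈ traceOn P (affineSpan ℝ ({↑i, ↑j} : Set (ℝ × ℝ))) :=
    mem_traceOn.mpr (right_mem_affineSpan_pair _ _ _)
  refine ⟨_, ⟨mem_lineTraces.mpr ⟨?_, _, isLine_affineSpan h, rfl⟩, hi, hj⟩, ?_⟩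
  · exact Finset.one_lt_card.mpr ⟨i, hi, j, hj, hij⟩
  · rintro S ⟨hS, hiS, hjS⟩
    obtain ⟨-, L, hL, rfl⟩ := mem_lineTraces.mp hS
    rw [traceOn_injOn P hL (isLine_affineSpan h) hij hiS hjS hi hj]

theorem ncard_lines_eq (P : Finset (ℝ × ℝ)) {m : ℕ} (hm : 2 ≤ m) :
    {L : Set (ℝ × ℝ) | IsLine L ∧ (ptsOn P L).card = m}.ncard =
      ((lineTraces P).filter fun S => S.card = m).card := by
  rw [← Set.ncard_coe_finset, ← Set.InjOn.ncard_image (f := traceOn P)]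
  · congr 1
    ext S
    simp only [Set.mem_image, Set.mem_ofPred_eq, Finset.coe_filter, mem_lineTraces]
    constructor
    · rintro ⟨L, ⟨hL, hc⟩, rfl⟩
      rw [← card_traceOn] at hc
      exact ⟨⟨hc ▸ hm, L, hL, rfl⟩, hc⟩
    · rintro ⟨⟨-, L, hL, rfl⟩, hc⟩
      exact ⟨L, ⟨hL, card_traceOn P L ▸ hc⟩, rfl⟩
  · rintro L ⟨hL, hc⟩ L' ⟨hL', -⟩ he
    rw [← card_traceOn] at hc
    obtain ⟨i, hi, j, hj, hij⟩ := Finset.one_lt_card.mp (hm.trans_eq hc.symm)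
    exact traceOn_injOn P hL hL' hij hi hj (he ▸ hi) (he ▸ hj)

theorem exists_injOn_fst_add_mul_snd (P : Finset (ℝ × ℝ)) :
    ∃ s : ℝ, Function.Injective fun i : P => i.1.1 + s * i.1.2 := by
  obtain ⟨s, hs⟩ := Infinite.exists_notMem_finset
    ((P ×ˢ P).image fun z => -(z.1.1 - z.2.1) / (z.1.2 - z.2.2))
  refine ⟨s, fun i j hij => ?_⟩
  by_contra hne
  have h2 : i.1.2 - j.1.2 ≠ 0 := fun h2 => by
    have h2' : i.1.2 = j.1.2 := by linarith
    simp only [h2', add_left_inj] at hij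
    exact hne (Subtype.ext (Prod.ext hij h2'))
  refine hs (Finset.mem_image.mpr ⟨(i.1, j.1), Finset.mk_mem_product i.2 j.2, ?_⟩)
  simp only at hij ⊢
  rw [div_eq_iff h2]
  linarith

theorem exists_snd_add_ne_zero (P : Finset (ℝ × ℝ)) : ∃ τ : ℝ, ∀ i : P, i.1.2 + τ ≠ 0 := by
  obtain ⟨τ, hτ⟩ := Infinite.exists_notMem_finset (P.image fun z => -z.2)
  refine ⟨τ, fun i hi => hτ (Finset.mem_image.mpr ⟨i.1, i.2, by linarith⟩)⟩

theorem sq_add_le_sum_card_lineTraces {P : Finset (ℝ × ℝ)} {n : ℕ} (hn : P.card = n) (hn3 : 3 ≤ n)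
    (hc : ∀ S ∈ lineTraces P, 3 * S.card ≤ 2 * n) :
    n ^ 2 + 3 * n ≤ 3 * ∑ S ∈ lineTraces P, S.card := by
  obtain ⟨s, hs⟩ := exists_injOn_fst_add_mul_snd P
  obtain ⟨τ, hτ⟩ := exists_snd_add_ne_zero P
  have hslope : ∀ S : Finset P, ∃ w : ℝ × ℝ, S ∈ lineTraces P →
      ∀ k : P, k ∈ S ↔ k.1.2 + τ = w.1 * (k.1.1 + s * k.1.2) + w.2 := by
    intro S
    by_cases hS : S ∈ lineTraces P
    · obtain ⟨h2, L, hL, rfl⟩ := mem_lineTraces.mp hS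
      obtain ⟨a, b, c, hbc, hz⟩ := hL.exists_equation
      have hd : c - b * s ≠ 0 := by
        intro hd
        have hb : b ≠ 0 := fun hb => by simp_all
        obtain ⟨i, hi, j, hj, hij⟩ := Finset.one_lt_card.mp h2
        rw [mem_traceOn, hz] at hi hj
        refine hij (hs (mul_left_cancel₀ hb ?_))
        simp only
        linear_combination hi - hj - (i.1.2 - j.1.2) * hd
      refine ⟨(-b / (c - b * s), τ - a / (c - b * s)), fun _ k => ?_⟩
      rw [mem_traceOn, hz]
      simp only
      constructor
      · intro h
        field_simp
        linear_combination h
      · intro h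
        field_simp at h
        linear_combination h
    · exact ⟨0, fun h => absurd h hS⟩
  choose w hw using hslope
  refine sq_add_le_sum_card (u := fun S => (w S).1) (v := fun S => (w S).2) hs hτ hw
    (fun S hS => (mem_lineTraces.mp hS).1) existsUnique_mem_lineTraces (by simpa using hn) hn3
    fun α β γ hβγ => ?_
  by_contra! hlt
  obtain ⟨i, hi, j, hj, hij⟩ := Finset.one_lt_card.mp (show 1 < (Finset.univ.filter
    fun i : P => α + β * (i.1.1 + s * i.1.2) + γ * (i.1.2 + τ) = 0).card by omega)
  have h : (i : ℝ × ℝ) ≠ j := fun e => hij (Subtype.ext e)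
  simp only [Finset.mem_filter, Finset.mem_univ, true_and] at hi hj
  have hbc : β ≠ 0 ∨ β * s + γ ≠ 0 := by
    by_contra! hb
    exact hβγ.elim (· hb.1) (· (by simpa [hb.1] using hb.2))
  have hmem := mem_affineSpan_pair_iff_of_eq_zero (a := α + γ * τ) hbc h
    (by linear_combination hi) (by linear_combination hj)
  have htr : traceOn P (affineSpan ℝ ({↑i, ↑j} : Set (ℝ × ℝ))) = Finset.univ.filter
      fun i : P => α + β * (i.1.1 + s * i.1.2) + γ * (i.1.2 + τ) = 0 := by
    ext k
    rw [mem_traceOn, SetLike.mem_coe, hmem, Finset.mem_filter, and_iff_right (Finset.mem_univ _)]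
    constructor <;> intro h <;> linear_combination h
  rw [← htr] at hlt
  refine absurd (hc _ (mem_lineTraces.mpr ⟨?_, _, isLine_affineSpan h, rfl⟩)) hlt.not_ge
  omega

end

/-- **Hirzebruch's inequality.** If `P` is a set of `n` points, no line containing
more than `n - 3` of them, and `t i` is the number of lines with exactly `i` points
of `P`, then `t₂ + (3/4) t₃ ≥ n + ∑_{i ≥ 5} (2i - 9) t_i`.  (Lines with more than
`n` points do not exist, so the sum may be taken over `5 ≤ i ≤ n`.) -/
theorem hirzebruch_inequality
    (P : Finset (ℝ × ℝ)) (n : ℕ) (hn : P.card = n)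
    (hline : ∀ L : Set (ℝ × ℝ), IsLine L → (ptsOn P L).card ≤ n - 3)
    (t : ℕ → ℕ)
    (ht : ∀ i, t i = {L : Set (ℝ × ℝ) | IsLine L ∧ (ptsOn P L).card = i}.ncard) :
    (n : ℝ) + ∑ i ∈ Finset.Icc 5 n, (2 * (i : ℝ) - 9) * t i
      ≤ (t 2 : ℝ) + (3 / 4) * t 3 := by
  obtain rfl | hpos := Nat.eq_zero_or_pos n
  · simp only [Nat.cast_zero, zero_add, Finset.Icc_eq_empty_of_lt (show 0 < 5 by norm_num),
      Finset.sum_empty]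
    positivity
  have hmax : ∀ S ∈ lineTraces P, S.card + 3 ≤ n := by
    intro S hS
    obtain ⟨h2, L, hL, rfl⟩ := mem_lineTraces.mp hS
    have := hline L hL
    rw [← card_traceOn] at this
    omega
  have hn5 : 5 ≤ n := by
    obtain ⟨p, hp⟩ := Finset.card_pos.mp (hn ▸ hpos)
    have hpq : p ≠ (p.1 + 1, p.2) := fun h => by simpa using congrArg Prod.fst h
    have h1 := hline _ (isLine_affineSpan hpq)
    have h0 : 0 < (ptsOn P (affineSpan ℝ ({p, (p.1 + 1, p.2)} : Set (ℝ × ℝ)))).card :=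
      Finset.card_pos.mpr ⟨p, Finset.mem_filter.mpr ⟨hp, left_mem_affineSpan_pair _ _ _⟩⟩
    obtain ⟨i, j, hij⟩ := Fintype.one_lt_card_iff.mp
      (show 1 < Fintype.card P by rw [Fintype.card_coe]; omega)
    obtain ⟨S, ⟨hS, -⟩, -⟩ := existsUnique_mem_lineTraces i j hij
    have := hmax S hS
    have := (mem_lineTraces.mp hS).1
    omega
  have key := card_le_sum_lineWeight (by rw [Fintype.card_coe, hn])
    (fun S hS => (mem_lineTraces.mp hS).1) existsUnique_mem_lineTraces hmax
    (sq_add_le_sum_card_lineTraces hn (by omega))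
  have hsum : ∑ S ∈ lineTraces P, lineWeight S.card =
      ∑ m ∈ Finset.Icc 2 n, lineWeight m * t m := by
    rw [← Finset.sum_fiberwise_of_maps_to (g := Finset.card) (t := Finset.Icc 2 n) fun S hS =>
      Finset.mem_Icc.mpr ⟨(mem_lineTraces.mp hS).1, by have := hmax S hS; omega⟩]
    refine Finset.sum_congr rfl fun m hm => ?_
    rw [Finset.sum_congr rfl fun S hS => by rw [(Finset.mem_filter.mp hS).2], Finset.sum_const,
      nsmul_eq_mul, ht, ncard_lines_eq P (Finset.mem_Icc.mp hm).1, mul_comm]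
  have htail : ∑ m ∈ Finset.Icc 5 n, lineWeight m * t m =
      -∑ m ∈ Finset.Icc 5 n, (2 * (m : ℝ) - 9) * t m := by
    rw [← Finset.sum_neg_distrib]
    refine Finset.sum_congr rfl fun m hm => ?_
    have := (Finset.mem_Icc.mp hm).1
    rw [lineWeight, if_neg (by omega), if_neg (by omega), if_neg (by omega)]
    ring
  rw [hsum, ← Finset.add_sum_Ioc_eq_sum_Icc (by omega), ← Finset.Icc_add_one_left_eq_Ioc,
    ← Finset.add_sum_Ioc_eq_sum_Icc (by omega), ← Finset.Icc_add_one_left_eq_Ioc,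
    ← Finset.add_sum_Ioc_eq_sum_Icc (by omega), ← Finset.Icc_add_one_left_eq_Ioc] at key
  norm_num [htail] at key
  simp only [lineWeight] at key
  norm_num at key
  linarith
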